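/- Let N_1, …, N_J (J ∈ ℕ) be unital *-subalgebras of the d×d complex matrices, with E_j the Hilbert–Schmidt orthogonal projection onto N_j, and let E be the Hilbert–Schmidt orthogonal projection onto the intersection N := N_1 ∩ ⋯ ∩ N_J. Let S be a finite set of finite nonempty sequences with entries in {1,…,J}, with weights μ : S → [0,1] summing to 1; for s = (j_1,…,j_m) ∈ S write E^s := E_{j_1} ∘ ⋯ ∘ E_{j_m}, and let k_{s,j} be a natural number at least the number of occurrences of j in s. Let ζ ∈ (0,1), c ≥ 1, and let Φ be a positive trace-preserving linear map on d×d complex matrices such that Σ_{s∈S} μ(s)·E^s = (1−ζ)·E + ζ·Φ as linear maps. Let ρ be a positive definite density with Φ(ρ) ≤ c·E(ρ) in the Loewner order. Then Σ_{s∈S} μ(s) · Σ_{j=1}^J k_{s,j} · D(ρ‖E_j(ρ)) ≥ β_{c,ζ} · D(ρ‖E(ρ)), where β_{c,ζ} := (1/(1 + ζ(c+1) + 2ζ²(c−1))) · (1 − 3ζ(2+ζ)·(c−1)²/(c(ln c − 1) + 1) − 8ζ − 2ζ²), with the convention that (c−1)²/(c(ln c − 1) + 1) = 0 when c = 1. 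-/

import Mathlib

open Matrix
open scoped ComplexOrder

/-- Matrix logarithm of a Hermitian matrix via functional calculus
(junk value `0` for non-Hermitian input). -/
noncomputable def matLog {d : ℕ} (A : Matrix (Fin d) (Fin d) ℂ) : Matrix (Fin d) (Fin d) ℂ :=
  if hA : A.IsHermitian then hA.cfc Real.log else 0

/-- Umegaki relative entropy `D(ρ‖σ) = Re tr (ρ (log ρ - log σ))`. -/
noncomputable def relEnt {d : ℕ} (ρ σ : Matrix (Fin d) (Fin d) ℂ) : ℝ :=
  ((ρ * (matLog ρ - matLog σ)).trace).re

/-- A density matrix: positive semidefinite with trace one. -/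
def IsDensity {d : ℕ} (ρ : Matrix (Fin d) (Fin d) ℂ) : Prop :=
  ρ.PosSemidef ∧ ρ.trace = 1

/-- `ρ` majorizes `σ`: for every `k`, the maximum over `k`-element index sets of the
sum of corresponding eigenvalues of `ρ` dominates the analogous maximum for `σ`. -/
def Majorizes {d : ℕ} {ρ σ : Matrix (Fin d) (Fin d) ℂ}
    (hρ : ρ.IsHermitian) (hσ : σ.IsHermitian) : Prop :=
  ∀ k : ℕ, k ≤ d → ∀ T : Finset (Fin d), T.card = k →
    ∃ S : Finset (Fin d), S.card = k ∧ ∑ i ∈ T, hσ.eigenvalues i ≤ ∑ i ∈ S, hρ.eigenvalues i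


/-- Composition `E^s = E_{j₁} ∘ ⋯ ∘ E_{jₘ}` of a finite sequence of linear maps. -/
def compSeq {d J : ℕ}
    (Es : Fin J → (Matrix (Fin d) (Fin d) ℂ →ₗ[ℂ] Matrix (Fin d) (Fin d) ℂ)) :
    List (Fin J) → (Matrix (Fin d) (Fin d) ℂ →ₗ[ℂ] Matrix (Fin d) (Fin d) ℂ) :=
  fun s => s.foldr (fun j acc => (Es j).comp acc) LinearMap.id

section EigenForm

variable {d : ℕ} {A B : Matrix (Fin d) (Fin d) ℂ}

/-- The matrix of `X` with respect to the eigenbases of `A` (rows) and `B` (columns). -/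
noncomputable def eigenCoeff (hA : A.IsHermitian) (hB : B.IsHermitian)
    (X : Matrix (Fin d) (Fin d) ℂ) : Matrix (Fin d) (Fin d) ℂ :=
  star (hA.eigenvectorUnitary : Matrix (Fin d) (Fin d) ℂ) * X * hB.eigenvectorUnitary

lemma eigenCoeff_cfc (hA : A.IsHermitian) (hB : B.IsHermitian) (f g : ℝ → ℝ)
    (X : Matrix (Fin d) (Fin d) ℂ) (i j : Fin d) :
    eigenCoeff hA hB (hA.cfc f * X * hB.cfc g) i j =
      f (hA.eigenvalues i) * eigenCoeff hA hB X i j * g (hB.eigenvalues j) := by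
  have h : eigenCoeff hA hB (hA.cfc f * X * hB.cfc g) =
      diagonal (RCLike.ofReal ∘ f ∘ hA.eigenvalues) * eigenCoeff hA hB X *
        diagonal (RCLike.ofReal ∘ g ∘ hB.eigenvalues) := by
    simp only [eigenCoeff, IsHermitian.cfc, Unitary.conjStarAlgAut_apply]
    have hu := Unitary.coe_star_mul_self hA.eigenvectorUnitary
    have hv := Unitary.coe_star_mul_self hB.eigenvectorUnitary
    simp only [← mul_assoc, hu, one_mul]
    simp only [mul_assoc, hv, mul_one]
  rw [h, mul_diagonal, diagonal_mul]
  rfl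

lemma cfc_id_eq (hA : A.IsHermitian) : hA.cfc id = A := by
  conv_rhs => rw [hA.spectral_theorem]
  rfl

lemma cfc_one_eq (hA : A.IsHermitian) : hA.cfc (fun _ => 1) = 1 := by
  have : (RCLike.ofReal ∘ (fun _ => (1 : ℝ)) ∘ hA.eigenvalues : Fin d → ℂ) = fun _ => 1 := by
    ext; simp
  rw [IsHermitian.cfc, this, diagonal_one, map_one]

lemma eigenCoeff_mul_left (hA : A.IsHermitian) (hB : B.IsHermitian)
    (X : Matrix (Fin d) (Fin d) ℂ) (i j : Fin d) :
    eigenCoeff hA hB (A * X) i j = hA.eigenvalues i * eigenCoeff hA hB X i j := by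
  have h := eigenCoeff_cfc hA hB id (fun _ => 1) X i j
  rwa [cfc_id_eq, cfc_one_eq, mul_one, id, Complex.ofReal_one, mul_one] at h

lemma eigenCoeff_mul_right (hA : A.IsHermitian) (hB : B.IsHermitian)
    (X : Matrix (Fin d) (Fin d) ℂ) (i j : Fin d) :
    eigenCoeff hA hB (X * B) i j = hB.eigenvalues j * eigenCoeff hA hB X i j := by
  have h := eigenCoeff_cfc hA hB (fun _ => 1) id X i j
  rwa [cfc_id_eq, cfc_one_eq, one_mul, id, Complex.ofReal_one, one_mul, mul_comm] at h

lemma eigenCoeff_add (hA : A.IsHermitian) (hB : B.IsHermitian)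
    (X Y : Matrix (Fin d) (Fin d) ℂ) :
    eigenCoeff hA hB (X + Y) = eigenCoeff hA hB X + eigenCoeff hA hB Y := by
  simp [eigenCoeff, mul_add, add_mul]

lemma eigenCoeff_sub (hA : A.IsHermitian) (hB : B.IsHermitian)
    (X Y : Matrix (Fin d) (Fin d) ℂ) :
    eigenCoeff hA hB (X - Y) = eigenCoeff hA hB X - eigenCoeff hA hB Y := by
  simp [eigenCoeff, mul_sub, sub_mul]

lemma eigenCoeff_smul (hA : A.IsHermitian) (hB : B.IsHermitian) (r : ℝ)
    (X : Matrix (Fin d) (Fin d) ℂ) :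
    eigenCoeff hA hB (r • X) = r • eigenCoeff hA hB X := by
  simp [eigenCoeff]

lemma exists_eigenCoeff_eq (hA : A.IsHermitian) (hB : B.IsHermitian)
    (Z : Matrix (Fin d) (Fin d) ℂ) : ∃ Y, eigenCoeff hA hB Y = Z := by
  refine ⟨(hA.eigenvectorUnitary : Matrix (Fin d) (Fin d) ℂ) * Z *
    star (hB.eigenvectorUnitary : Matrix (Fin d) (Fin d) ℂ), ?_⟩
  have hu := Unitary.coe_star_mul_self hA.eigenvectorUnitary
  have hv := Unitary.coe_star_mul_self hB.eigenvectorUnitary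
  simp only [eigenCoeff, ← mul_assoc, hu, one_mul]
  simp only [mul_assoc, hv, mul_one]

lemma eigenCoeff_injective (hA : A.IsHermitian) (hB : B.IsHermitian) :
    Function.Injective (eigenCoeff hA hB) := by
  intro X Y h
  have hu := Unitary.mul_star_self_of_mem hA.eigenvectorUnitary.2
  have hv := Unitary.mul_star_self_of_mem hB.eigenvectorUnitary.2
  have key : ∀ Z, (hA.eigenvectorUnitary : Matrix (Fin d) (Fin d) ℂ) * eigenCoeff hA hB Z *
      star (hB.eigenvectorUnitary : Matrix (Fin d) (Fin d) ℂ) = Z := by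
    intro Z
    simp only [eigenCoeff, ← mul_assoc, hu, one_mul]
    simp only [mul_assoc, hv, mul_one]
  rw [← key X, h, key]

lemma trace_conjTranspose_mul_eigenCoeff (hA : A.IsHermitian) (hB : B.IsHermitian)
    (X Y : Matrix (Fin d) (Fin d) ℂ) :
    ((Xᴴ * Y).trace).re =
      ∑ i, ∑ j, (star (eigenCoeff hA hB X i j) * eigenCoeff hA hB Y i j).re := by
  have hu := Unitary.mul_star_self_of_mem hA.eigenvectorUnitary.2
  have hv := Unitary.mul_star_self_of_mem hB.eigenvectorUnitary.2
  have h : (eigenCoeff hA hB X)ᴴ * eigenCoeff hA hB Y =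
      star (hB.eigenvectorUnitary : Matrix (Fin d) (Fin d) ℂ) * (Xᴴ * Y) *
        (hB.eigenvectorUnitary : Matrix (Fin d) (Fin d) ℂ) := by
    simp only [eigenCoeff, conjTranspose_mul, star_eq_conjTranspose, conjTranspose_conjTranspose]
      at hu ⊢
    simp only [mul_assoc]
    rw [← mul_assoc (hA.eigenvectorUnitary : Matrix (Fin d) (Fin d) ℂ), hu, one_mul]
  have h2 : (Xᴴ * Y).trace = ((eigenCoeff hA hB X)ᴴ * eigenCoeff hA hB Y).trace := by
    rw [h, trace_mul_cycle, hv, one_mul]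
  rw [h2, Finset.sum_comm]
  simp [trace, mul_apply]

/-- The quadratic form `X ↦ ⟨X, f(L_A, R_B) X⟩`, where `L_A` and `R_B` are left multiplication by
`A` and right multiplication by `B`. -/
noncomputable def eigenForm (f : ℝ → ℝ → ℝ) (hA : A.IsHermitian) (hB : B.IsHermitian)
    (X : Matrix (Fin d) (Fin d) ℂ) : ℝ :=
  ∑ i, ∑ j, f (hA.eigenvalues i) (hB.eigenvalues j) * Complex.normSq (eigenCoeff hA hB X i j)

lemma eigenForm_mono {f g : ℝ → ℝ → ℝ} (hA : A.PosDef) (hB : B.PosDef)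
    (X : Matrix (Fin d) (Fin d) ℂ) (h : ∀ p q, 0 < p → 0 < q → f p q ≤ g p q) :
    eigenForm f hA.1 hB.1 X ≤ eigenForm g hA.1 hB.1 X :=
  Finset.sum_le_sum fun i _ => Finset.sum_le_sum fun j _ =>
    mul_le_mul_of_nonneg_right (h _ _ (hA.eigenvalues_pos i) (hB.eigenvalues_pos j))
      (Complex.normSq_nonneg _)

lemma eigenForm_congr {f g : ℝ → ℝ → ℝ} (hA : A.PosDef) (hB : B.PosDef)
    (X : Matrix (Fin d) (Fin d) ℂ) (h : ∀ p q, 0 < p → 0 < q → f p q = g p q) :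
    eigenForm f hA.1 hB.1 X = eigenForm g hA.1 hB.1 X :=
  le_antisymm (eigenForm_mono hA hB X fun p q hp hq => (h p q hp hq).le)
    (eigenForm_mono hA hB X fun p q hp hq => (h p q hp hq).ge)

lemma eigenForm_nonneg {f : ℝ → ℝ → ℝ} (hA : A.PosDef) (hB : B.PosDef)
    (X : Matrix (Fin d) (Fin d) ℂ) (h : ∀ p q, 0 < p → 0 < q → 0 ≤ f p q) :
    0 ≤ eigenForm f hA.1 hB.1 X :=
  Finset.sum_nonneg fun i _ => Finset.sum_nonneg fun j _ =>
    mul_nonneg (h _ _ (hA.eigenvalues_pos i) (hB.eigenvalues_pos j)) (Complex.normSq_nonneg _)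

lemma eigenForm_smul (f : ℝ → ℝ → ℝ) (hA : A.IsHermitian) (hB : B.IsHermitian) (r : ℝ)
    (X : Matrix (Fin d) (Fin d) ℂ) :
    eigenForm f hA hB (r • X) = r ^ 2 * eigenForm f hA hB X := by
  simp only [eigenForm, Finset.mul_sum, eigenCoeff_smul, Matrix.smul_apply, Complex.real_smul,
    Complex.normSq_mul, Complex.normSq_ofReal]
  exact Finset.sum_congr rfl fun i _ => Finset.sum_congr rfl fun j _ => by ring

lemma eigenForm_sub_self (f : ℝ → ℝ → ℝ) (hA : A.IsHermitian) (hB : B.IsHermitian) :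
    eigenForm f hA hB (A - B) = eigenForm (fun p q => (p - q) ^ 2 * f p q) hA hB 1 := by
  unfold eigenForm
  refine Finset.sum_congr rfl fun i _ => Finset.sum_congr rfl fun j _ => ?_
  have h1 := eigenCoeff_mul_left hA hB 1 i j
  have h2 := eigenCoeff_mul_right hA hB 1 i j
  rw [mul_one] at h1
  rw [one_mul] at h2
  rw [eigenCoeff_sub, Matrix.sub_apply, h1, h2, ← sub_mul, Complex.normSq_mul,
    ← Complex.ofReal_sub, Complex.normSq_ofReal]
  ring

lemma trace_cfc_mul_cfc (hA : A.IsHermitian) (hB : B.IsHermitian) (f g : ℝ → ℝ) :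
    ((hA.cfc f * hB.cfc g).trace).re = eigenForm (fun p q => f p * g q) hA hB 1 := by
  have h := trace_conjTranspose_mul_eigenCoeff hA hB 1 (hA.cfc f * 1 * hB.cfc g)
  rw [conjTranspose_one, one_mul, mul_one] at h
  rw [h]
  refine Finset.sum_congr rfl fun i _ => Finset.sum_congr rfl fun j _ => ?_
  have h3 := eigenCoeff_cfc hA hB f g 1 i j
  rw [mul_one] at h3
  rw [h3]
  simp [Complex.normSq_apply]
  ring

/-- Nonnegative forms inherit `(1 - θ)‖x‖² - θ(1 - θ)‖y‖² ≤ ‖x - θ y‖²` from complex numbers. -/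
lemma eigenForm_sub_smul_ge {f : ℝ → ℝ → ℝ} (hA : A.PosDef) (hB : B.PosDef)
    (hf : ∀ p q, 0 < p → 0 < q → 0 ≤ f p q) {θ : ℝ} (hθ : 0 ≤ θ)
    (X Y : Matrix (Fin d) (Fin d) ℂ) :
    (1 - θ) * eigenForm f hA.1 hB.1 X - θ * (1 - θ) * eigenForm f hA.1 hB.1 Y ≤
      eigenForm f hA.1 hB.1 (X - θ • Y) := by
  simp only [eigenForm, Finset.mul_sum, ← Finset.sum_sub_distrib]
  refine Finset.sum_le_sum fun i _ => Finset.sum_le_sum fun j _ => ?_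
  have h := hf _ _ (hA.eigenvalues_pos i) (hB.eigenvalues_pos j)
  rw [eigenCoeff_sub, eigenCoeff_smul]
  simp only [Matrix.sub_apply, Matrix.smul_apply, Complex.real_smul]
  generalize eigenCoeff hA.1 hB.1 X i j = x
  generalize eigenCoeff hA.1 hB.1 Y i j = y
  have key : (1 - θ) * Complex.normSq x - θ * (1 - θ) * Complex.normSq y ≤
      Complex.normSq (x - θ * y) := by
    simp only [Complex.normSq_apply, Complex.sub_re, Complex.sub_im, Complex.mul_re,
      Complex.mul_im, Complex.ofReal_re, Complex.ofReal_im]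
    nlinarith [mul_nonneg hθ (sq_nonneg (x.re - y.re)), mul_nonneg hθ (sq_nonneg (x.im - y.im))]
  nlinarith [mul_le_mul_of_nonneg_left key h]

end EigenForm

section Kernel

open MeasureTheory Filter Topology

/-- The kernels `∫₀^∞ dt / ((1 + t)ᵏ (p + t q))`. For `k = 1` this is the reciprocal of the
logarithmic mean of `p` and `q`. -/
noncomputable def logKernel (k : ℕ) (p q : ℝ) : ℝ :=
  ∫ t in Set.Ioi (0 : ℝ), ((1 + t) ^ k)⁻¹ * (p + t * q)⁻¹

lemma tendsto_inv_one_add : Tendsto (fun t : ℝ => (1 + t)⁻¹) atTop (𝓝 0) :=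
  tendsto_inv_atTop_zero.comp (tendsto_atTop_add_const_left atTop 1 tendsto_id)

lemma hasDerivAt_inv_one_add {t : ℝ} (ht : 0 ≤ t) :
    HasDerivAt (fun t : ℝ => (1 + t)⁻¹) (-((1 + t) ^ 2)⁻¹) t := by
  have h := ((hasDerivAt_id' t).const_add 1).fun_inv (by positivity)
  exact h.congr_deriv (by rw [neg_div, one_div])

lemma integrableOn_inv_one_add_sq :
    IntegrableOn (fun t : ℝ => ((1 + t) ^ 2)⁻¹) (Set.Ioi 0) := by
  refine integrableOn_Ioi_deriv_of_nonneg' (g := fun t => -(1 + t)⁻¹) (l := 0)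
    (fun t ht => ?_) (fun t _ => by positivity) (by simpa using tendsto_inv_one_add.neg)
  simpa using (hasDerivAt_inv_one_add ht).fun_neg

lemma integrableOn_logKernel {k : ℕ} (hk : 1 ≤ k) {p q : ℝ} (hp : 0 < p) (hq : 0 < q) :
    IntegrableOn (fun t : ℝ => ((1 + t) ^ k)⁻¹ * (p + t * q)⁻¹) (Set.Ioi 0) := by
  have hm : 0 < min p q := lt_min hp hq
  refine Integrable.mono' (integrableOn_inv_one_add_sq.const_mul (min p q)⁻¹) ?_ ?_
  · exact (by fun_prop : Measurable fun t : ℝ =>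
      ((1 + t) ^ k)⁻¹ * (p + t * q)⁻¹).aestronglyMeasurable
  · refine (ae_restrict_iff' measurableSet_Ioi).2 (Eventually.of_forall fun t ht => ?_)
    have ht : 0 < t := ht
    rw [Real.norm_of_nonneg (by positivity), ← mul_inv, ← mul_inv]
    refine inv_anti₀ (by positivity) ?_
    have h1 : min p q * (1 + t) ≤ p + t * q := by
      nlinarith [min_le_left p q, min_le_right p q]
    have h2 : 1 + t ≤ (1 + t) ^ k := le_self_pow₀ (by linarith) (by omega)
    calc min p q * (1 + t) ^ 2 = (1 + t) * (min p q * (1 + t)) := by ring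
      _ ≤ (1 + t) ^ k * (p + t * q) := by gcongr

lemma tendsto_log_sub_log {p q : ℝ} (hp : 0 < p) (hq : 0 < q) :
    Tendsto (fun t : ℝ => Real.log (p + t * q) - Real.log (1 + t)) atTop (𝓝 (Real.log q)) := by
  have h : Tendsto (fun t : ℝ => q + (p - q) * (1 + t)⁻¹) atTop (𝓝 q) := by
    simpa using (tendsto_inv_one_add.const_mul (p - q)).const_add q
  refine ((Real.continuousAt_log hq.ne').tendsto.comp h).congr' ?_
  filter_upwards [eventually_ge_atTop 0] with t ht
  have h1 : 0 < 1 + t := by linarith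
  have h2 : 0 < p + t * q := by positivity
  rw [← Real.log_div h2.ne' h1.ne', Function.comp]
  congr 1
  field_simp
  ring

lemma hasDerivAt_log_sub_log {p q t : ℝ} (hp : 0 < p) (hq : 0 < q) (ht : 0 ≤ t) :
    HasDerivAt (fun t : ℝ => Real.log (p + t * q) - Real.log (1 + t))
      (q / (p + t * q) - 1 / (1 + t)) t := by
  have h1 : HasDerivAt (fun t : ℝ => p + t * q) q t := by
    simpa using ((hasDerivAt_id t).mul_const q).const_add p
  have h2 : HasDerivAt (fun t : ℝ => 1 + t) 1 t := (hasDerivAt_id t).const_add 1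
  exact (h1.log (by positivity)).fun_sub (h2.log (by positivity))

lemma sub_mul_logKernel_one {p q : ℝ} (hp : 0 < p) (hq : 0 < q) :
    (p - q) * logKernel 1 p q = Real.log p - Real.log q := by
  rw [logKernel, ← integral_const_mul,
    integral_Ioi_of_hasDerivAt_of_tendsto'
      (f := fun t : ℝ => -(Real.log (p + t * q) - Real.log (1 + t))) (m := -Real.log q)
      (fun t ht => ?_) ((integrableOn_logKernel le_rfl hp hq).const_mul _)
      (tendsto_log_sub_log hp hq).neg]
  · simp; ring
  · have ht : 0 ≤ t := ht
    have h1 : 1 + t ≠ 0 := by positivity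
    have h2 : p + t * q ≠ 0 := by positivity
    refine (hasDerivAt_log_sub_log hp hq ht).fun_neg.congr_deriv ?_
    field_simp
    ring

lemma sub_sq_mul_logKernel_two {p q : ℝ} (hp : 0 < p) (hq : 0 < q) :
    (p - q) ^ 2 * logKernel 2 p q = q * Real.log q - q * Real.log p + p - q := by
  have hlim : Tendsto (fun t : ℝ => q * (Real.log (p + t * q) - Real.log (1 + t)) -
      (p - q) * (1 + t)⁻¹) atTop (𝓝 (q * Real.log q)) := by
    simpa using ((tendsto_log_sub_log hp hq).const_mul q).sub
      (tendsto_inv_one_add.const_mul (p - q))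
  rw [logKernel, ← integral_const_mul,
    integral_Ioi_of_hasDerivAt_of_tendsto' (fun t ht => ?_)
      ((integrableOn_logKernel one_le_two hp hq).const_mul _) hlim]
  · simp; ring
  · have ht : 0 ≤ t := ht
    have h1 : 1 + t ≠ 0 := by positivity
    have h2 : p + t * q ≠ 0 := by positivity
    refine (((hasDerivAt_log_sub_log hp hq ht).const_mul q).fun_sub
      ((hasDerivAt_inv_one_add ht).const_mul (p - q))).congr_deriv ?_
    field_simp
    ring

lemma logKernel_nonneg (k : ℕ) {p q : ℝ} (hp : 0 < p) (hq : 0 < q) : 0 ≤ logKernel k p q :=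
  setIntegral_nonneg measurableSet_Ioi fun t ht => by
    have ht : 0 < t := ht
    positivity

end Kernel

section EntropyForms

open MeasureTheory

variable {d : ℕ} {A B : Matrix (Fin d) (Fin d) ℂ}

/-- The form `X ↦ ⟨X, (L_A + t R_B)⁻¹ X⟩`. -/
noncomputable def resolventForm (t : ℝ) (hA : A.IsHermitian) (hB : B.IsHermitian)
    (X : Matrix (Fin d) (Fin d) ℂ) : ℝ :=
  eigenForm (fun p q => (p + t * q)⁻¹) hA hB X

lemma eigenForm_logKernel {k : ℕ} (hk : 1 ≤ k) (hA : A.PosDef) (hB : B.PosDef)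
    (X : Matrix (Fin d) (Fin d) ℂ) :
    IntegrableOn (fun t : ℝ => ((1 + t) ^ k)⁻¹ * resolventForm t hA.1 hB.1 X) (Set.Ioi 0) ∧
    eigenForm (logKernel k) hA.1 hB.1 X =
      ∫ t in Set.Ioi (0 : ℝ), ((1 + t) ^ k)⁻¹ * resolventForm t hA.1 hB.1 X := by
  have hint : ∀ i j, IntegrableOn (fun t : ℝ =>
      ((1 + t) ^ k)⁻¹ * (hA.1.eigenvalues i + t * hB.1.eigenvalues j)⁻¹ *
        Complex.normSq (eigenCoeff hA.1 hB.1 X i j)) (Set.Ioi 0) := fun i j =>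
    (integrableOn_logKernel hk (hA.eigenvalues_pos i) (hB.eigenvalues_pos j)).mul_const _
  have hfun : (fun t : ℝ => ((1 + t) ^ k)⁻¹ * resolventForm t hA.1 hB.1 X) = fun t =>
      ∑ i, ∑ j, ((1 + t) ^ k)⁻¹ * (hA.1.eigenvalues i + t * hB.1.eigenvalues j)⁻¹ *
        Complex.normSq (eigenCoeff hA.1 hB.1 X i j) := by
    ext t
    simp only [resolventForm, eigenForm, Finset.mul_sum, mul_assoc]
  rw [hfun]
  refine ⟨integrable_finsetSum _ fun i _ => integrable_finsetSum _ fun j _ => hint i j, ?_⟩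
  rw [integral_finsetSum _ fun i _ => integrable_finsetSum _ fun j _ => hint i j]
  refine Finset.sum_congr rfl fun i _ => ?_
  rw [integral_finsetSum _ fun j _ => hint i j]
  refine Finset.sum_congr rfl fun j _ => ?_
  rw [integral_mul_const, logKernel]

/-- Inequalities between resolvent forms integrate to inequalities between kernel forms. -/
lemma eigenForm_logKernel_le_sum {k : ℕ} (hk : 1 ≤ k) (hA : A.PosDef) (hB : B.PosDef)
    (X : Matrix (Fin d) (Fin d) ℂ) {ι : Type*} (s : Finset ι) (c : ι → ℝ)
    {A' B' : ι → Matrix (Fin d) (Fin d) ℂ} (hA' : ∀ i, (A' i).PosDef) (hB' : ∀ i, (B' i).PosDef)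
    (X' : ι → Matrix (Fin d) (Fin d) ℂ)
    (h : ∀ t : ℝ, 0 < t → resolventForm t hA.1 hB.1 X ≤
      ∑ i ∈ s, c i * resolventForm t (hA' i).1 (hB' i).1 (X' i)) :
    eigenForm (logKernel k) hA.1 hB.1 X ≤
      ∑ i ∈ s, c i * eigenForm (logKernel k) (hA' i).1 (hB' i).1 (X' i) := by
  have hi := fun i => eigenForm_logKernel hk (hA' i) (hB' i) (X' i)
  rw [(eigenForm_logKernel hk hA hB X).2]
  simp only [(hi _).2, ← integral_const_mul]
  rw [← integral_finsetSum _ fun i _ => (hi i).1.const_mul (c i)]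
  refine setIntegral_mono_on (eigenForm_logKernel hk hA hB X).1
    (integrable_finsetSum _ fun i _ => (hi i).1.const_mul (c i)) measurableSet_Ioi
    fun t ht => ?_
  have ht : 0 < t := ht
  calc ((1 + t) ^ k)⁻¹ * resolventForm t hA.1 hB.1 X
      ≤ ((1 + t) ^ k)⁻¹ * ∑ i ∈ s, c i * resolventForm t (hA' i).1 (hB' i).1 (X' i) :=
        mul_le_mul_of_nonneg_left (h t ht) (by positivity)
    _ = _ := by
        rw [Finset.mul_sum]
        exact Finset.sum_congr rfl fun i _ => by ring

lemma eigenForm_logKernel_le {k : ℕ} (hk : 1 ≤ k) (hA : A.PosDef) (hB : B.PosDef)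
    (X : Matrix (Fin d) (Fin d) ℂ) (c : ℝ)
    {A' B' : Matrix (Fin d) (Fin d) ℂ} (hA' : A'.PosDef) (hB' : B'.PosDef)
    (X' : Matrix (Fin d) (Fin d) ℂ)
    (h : ∀ t : ℝ, 0 < t → resolventForm t hA.1 hB.1 X ≤ c * resolventForm t hA'.1 hB'.1 X') :
    eigenForm (logKernel k) hA.1 hB.1 X ≤ c * eigenForm (logKernel k) hA'.1 hB'.1 X' := by
  simpa using eigenForm_logKernel_le_sum hk hA hB X {()} (fun _ => c) (fun _ => hA')
    (fun _ => hB') (fun _ => X') (by simpa using h)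

lemma matLog_eq (hA : A.IsHermitian) : matLog A = hA.cfc Real.log := dif_pos hA

lemma cfc_mul_cfc (hA : A.IsHermitian) (f g : ℝ → ℝ) :
    hA.cfc f * hA.cfc g = hA.cfc (fun x => f x * g x) := by
  rw [IsHermitian.cfc, IsHermitian.cfc, IsHermitian.cfc, ← map_mul, diagonal_mul_diagonal]
  congr 2
  ext
  simp

lemma mul_matLog (hA : A.IsHermitian) : A * matLog A = hA.cfc (fun x => x * Real.log x) := by
  have h := cfc_mul_cfc hA id Real.log
  rwa [cfc_id_eq, ← matLog_eq] at h

lemma re_trace_left (hA : A.IsHermitian) (hB : B.IsHermitian) (f : ℝ → ℝ) :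
    (hA.cfc f).trace.re = eigenForm (fun p _ => f p) hA hB 1 := by
  simpa [cfc_one_eq] using trace_cfc_mul_cfc hA hB f (fun _ => 1)

lemma re_trace_right (hA : A.IsHermitian) (hB : B.IsHermitian) (f : ℝ → ℝ) :
    (hB.cfc f).trace.re = eigenForm (fun _ q => f q) hA hB 1 := by
  simpa [cfc_one_eq] using trace_cfc_mul_cfc hA hB (fun _ => 1) f

lemma relEnt_eq (ρ σ : Matrix (Fin d) (Fin d) ℂ) :
    relEnt ρ σ = (ρ * matLog ρ).trace.re - (ρ * matLog σ).trace.re := by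
  simp [relEnt, mul_sub]

lemma re_trace_mul_matLog (hA : A.IsHermitian) (hB : B.IsHermitian) :
    (B * matLog A).trace.re = eigenForm (fun p q => Real.log p * q) hA hB 1 := by
  have h := trace_cfc_mul_cfc hA hB Real.log id
  rwa [cfc_id_eq, ← matLog_eq, trace_mul_comm] at h

lemma re_trace_mul_matLog' (hA : A.IsHermitian) (hB : B.IsHermitian) :
    (A * matLog B).trace.re = eigenForm (fun p q => p * Real.log q) hA hB 1 := by
  have h := trace_cfc_mul_cfc hA hB id Real.log
  rwa [cfc_id_eq, ← matLog_eq] at h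

lemma relEnt_eq_eigenForm {ρ σ : Matrix (Fin d) (Fin d) ℂ} (hρ : ρ.PosDef) (hσ : σ.PosDef)
    (htr : ρ.trace = σ.trace) :
    relEnt ρ σ = eigenForm (logKernel 2) hσ.1 hρ.1 (σ - ρ) := by
  have h1 := re_trace_left hσ.1 hρ.1 id
  have h2 := re_trace_right hσ.1 hρ.1 id
  have h3 := re_trace_right hσ.1 hρ.1 (fun x => x * Real.log x)
  rw [cfc_id_eq] at h1 h2
  rw [relEnt_eq, mul_matLog hρ.1, h3, re_trace_mul_matLog hσ.1 hρ.1, eigenForm_sub_self,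
    eigenForm_congr hσ hρ 1 (fun p q hp hq => sub_sq_mul_logKernel_two hp hq)]
  have h0 : eigenForm (fun p _ => id p) hσ.1 hρ.1 1 - eigenForm (fun _ q => id q) hσ.1 hρ.1 1
      = 0 := by rw [← h1, ← h2, htr, sub_self]
  rw [← add_zero (_ - _), ← h0]
  simp only [eigenForm, ← Finset.sum_sub_distrib, ← Finset.sum_add_distrib]
  exact Finset.sum_congr rfl fun i _ => Finset.sum_congr rfl fun j _ => by simp only [id]; ring

lemma re_trace_sub_mul_matLog_sub (hA : A.PosDef) (hB : B.PosDef) :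
    ((A - B) * (matLog A - matLog B)).trace.re = eigenForm (logKernel 1) hA.1 hB.1 (A - B) := by
  have h3 := re_trace_left hA.1 hB.1 (fun x => x * Real.log x)
  have h4 := re_trace_right hA.1 hB.1 (fun x => x * Real.log x)
  rw [← mul_matLog] at h3 h4
  rw [sub_mul, mul_sub, mul_sub]
  simp only [trace_sub, Complex.sub_re]
  rw [h3, h4, re_trace_mul_matLog hA.1 hB.1, re_trace_mul_matLog' hA.1 hB.1, eigenForm_sub_self,
    eigenForm_congr hA hB 1 (f := fun p q => (p - q) ^ 2 * logKernel 1 p q)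
      (g := fun p q => (p - q) * (Real.log p - Real.log q))
      fun p q hp hq => by rw [← sub_mul_logKernel_one hp hq]; ring]
  simp only [eigenForm, ← Finset.sum_sub_distrib]
  exact Finset.sum_congr rfl fun i _ => Finset.sum_congr rfl fun j _ => by ring

lemma relEnt_nonneg {ρ σ : Matrix (Fin d) (Fin d) ℂ} (hρ : ρ.PosDef) (hσ : σ.PosDef)
    (htr : ρ.trace = σ.trace) : 0 ≤ relEnt ρ σ := by
  rw [relEnt_eq_eigenForm hρ hσ htr]
  exact eigenForm_nonneg hσ hρ _ fun p q hp hq => logKernel_nonneg 2 hp hq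

end EntropyForms

section Variational

variable {d : ℕ} {A B : Matrix (Fin d) (Fin d) ℂ}

lemma eigenCoeff_sylvester (hA : A.IsHermitian) (hB : B.IsHermitian) (t : ℝ)
    (Y : Matrix (Fin d) (Fin d) ℂ) (i j : Fin d) :
    eigenCoeff hA hB (A * Y + t • (Y * B)) i j =
      ((hA.eigenvalues i + t * hB.eigenvalues j : ℝ) : ℂ) * eigenCoeff hA hB Y i j := by
  rw [eigenCoeff_add, eigenCoeff_smul, Matrix.add_apply, Matrix.smul_apply, eigenCoeff_mul_left,
    eigenCoeff_mul_right, Complex.real_smul]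
  push_cast
  ring

lemma exists_sylvester (hA : A.PosDef) (hB : B.PosDef) {t : ℝ} (ht : 0 < t)
    (X : Matrix (Fin d) (Fin d) ℂ) : ∃ Y, A * Y + t • (Y * B) = X := by
  obtain ⟨Y, hY⟩ := exists_eigenCoeff_eq hA.1 hB.1 (fun i j =>
    ((hA.1.eigenvalues i + t * hB.1.eigenvalues j : ℝ) : ℂ)⁻¹ * eigenCoeff hA.1 hB.1 X i j)
  refine ⟨Y, eigenCoeff_injective hA.1 hB.1 ?_⟩
  ext i j
  have h : 0 < hA.1.eigenvalues i + t * hB.1.eigenvalues j :=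
    add_pos (hA.eigenvalues_pos i) (mul_pos ht (hB.eigenvalues_pos j))
  rw [eigenCoeff_sylvester, hY, mul_inv_cancel_left₀ (by exact_mod_cast h.ne')]

lemma resolventForm_sylvester (hA : A.PosDef) (hB : B.PosDef) {t : ℝ} (ht : 0 < t)
    {X Y : Matrix (Fin d) (Fin d) ℂ} (hY : A * Y + t • (Y * B) = X) :
    resolventForm t hA.1 hB.1 X = (Xᴴ * Y).trace.re := by
  rw [trace_conjTranspose_mul_eigenCoeff hA.1 hB.1, resolventForm, eigenForm]
  refine Finset.sum_congr rfl fun i _ => Finset.sum_congr rfl fun j _ => ?_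
  have h : 0 < hA.1.eigenvalues i + t * hB.1.eigenvalues j :=
    add_pos (hA.eigenvalues_pos i) (mul_pos ht (hB.eigenvalues_pos j))
  rw [← hY, eigenCoeff_sylvester]
  generalize hA.1.eigenvalues i + t * hB.1.eigenvalues j = m at h
  generalize eigenCoeff hA.1 hB.1 Y i j = y
  rw [Complex.normSq_mul, Complex.normSq_ofReal, star_mul', mul_assoc, Complex.star_def,
    Complex.conj_ofReal, mul_assoc, Complex.re_ofReal_mul,
    ← Complex.normSq_eq_conj_mul_self, Complex.ofReal_re]
  field_simp

lemma two_mul_re_trace_sub_le_resolventForm (hA : A.PosDef) (hB : B.PosDef) {t : ℝ} (ht : 0 < t)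
    (X Y : Matrix (Fin d) (Fin d) ℂ) :
    2 * (Xᴴ * Y).trace.re - (Yᴴ * (A * Y + t • (Y * B))).trace.re ≤
      resolventForm t hA.1 hB.1 X := by
  rw [trace_conjTranspose_mul_eigenCoeff hA.1 hB.1, trace_conjTranspose_mul_eigenCoeff hA.1 hB.1,
    resolventForm, eigenForm]
  simp only [Finset.mul_sum, ← Finset.sum_sub_distrib]
  refine Finset.sum_le_sum fun i _ => Finset.sum_le_sum fun j _ => ?_
  have h : 0 < hA.1.eigenvalues i + t * hB.1.eigenvalues j :=
    add_pos (hA.eigenvalues_pos i) (mul_pos ht (hB.eigenvalues_pos j))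
  rw [eigenCoeff_sylvester]
  generalize hA.1.eigenvalues i + t * hB.1.eigenvalues j = m at h
  generalize eigenCoeff hA.1 hB.1 X i j = x
  generalize eigenCoeff hA.1 hB.1 Y i j = y
  rw [le_inv_mul_iff₀ h]
  simp only [Complex.star_def, Complex.mul_re, Complex.conj_re, Complex.conj_im, Complex.mul_im,
    Complex.ofReal_re, Complex.ofReal_im, Complex.normSq_apply]
  nlinarith [sq_nonneg (x.re - m * y.re), sq_nonneg (x.im - m * y.im)]

lemma re_trace_conjTranspose_mul_comm (X Y : Matrix (Fin d) (Fin d) ℂ) :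
    (Xᴴ * Y).trace.re = (Yᴴ * X).trace.re := by
  rw [← Complex.conj_re (Yᴴ * X).trace, ← Complex.star_def, ← trace_conjTranspose,
    conjTranspose_mul, conjTranspose_conjTranspose]

lemma re_trace_conjTranspose_mul_sylvester (t : ℝ) (Y : Matrix (Fin d) (Fin d) ℂ) :
    (Yᴴ * (A * Y + t • (Y * B))).trace.re =
      (A * (Y * Yᴴ)).trace.re + t * (B * (Yᴴ * Y)).trace.re := by
  rw [mul_add, mul_smul_comm, trace_add, trace_smul, Complex.add_re, Complex.real_smul,
    Complex.re_ofReal_mul, trace_mul_comm, ← mul_assoc Yᴴ Y B, trace_mul_comm _ B, mul_assoc]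

open scoped MatrixOrder Matrix.Norms.L2Operator in
lemma re_trace_mul_le {P : Matrix (Fin d) (Fin d) ℂ} {κ : ℝ} (h : (κ • B - A).PosSemidef)
    (hP : P.PosSemidef) : (A * P).trace.re ≤ κ * (B * P).trace.re := by
  obtain ⟨Q, rfl⟩ := CStarAlgebra.nonneg_iff_eq_star_mul_self.1 hP.nonneg
  have h1 := (h.mul_mul_conjTranspose_same Q).trace_nonneg
  rw [mul_sub, sub_mul, trace_sub, mul_smul_comm, smul_mul_assoc, trace_smul] at h1
  have h2 := (Complex.le_def.1 h1).1
  simp only [Complex.zero_re, Complex.sub_re, Complex.real_smul, Complex.re_ofReal_mul] at h2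
  have h3 : ∀ M : Matrix (Fin d) (Fin d) ℂ, (M * (Qᴴ * Q)).trace = (Q * M * Qᴴ).trace := by
    intro M
    rw [← mul_assoc, trace_mul_comm, ← mul_assoc]
  rw [star_eq_conjTranspose, h3, h3]
  linarith

/-- The resolvent form is antitone in its two arguments, up to scaling. -/
lemma resolventForm_le_mul {A' B' : Matrix (Fin d) (Fin d) ℂ} (hA : A.PosDef) (hB : B.PosDef)
    (hA' : A'.PosDef) (hB' : B'.PosDef) {κ : ℝ} (hκ : 0 < κ) (h1 : (κ • A - A').PosSemidef)
    (h2 : (κ • B - B').PosSemidef) {t : ℝ} (ht : 0 < t) (X : Matrix (Fin d) (Fin d) ℂ) :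
    resolventForm t hA.1 hB.1 X ≤ κ * resolventForm t hA'.1 hB'.1 X := by
  obtain ⟨Y, hY⟩ := exists_sylvester hA hB ht X
  have h3 := resolventForm_sylvester hA hB ht hY
  have h4 := two_mul_re_trace_sub_le_resolventForm hA' hB' ht X (κ⁻¹ • Y)
  have h5 := re_trace_conjTranspose_mul_sylvester (A := A) (B := B) t Y
  rw [hY, ← re_trace_conjTranspose_mul_comm, ← h3] at h5
  have h6 := re_trace_mul_le h1 (posSemidef_self_mul_conjTranspose Y)
  have h7 := re_trace_mul_le h2 (posSemidef_conjTranspose_mul_self Y)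
  have h8 : (Xᴴ * (κ⁻¹ • Y)).trace.re = κ⁻¹ * resolventForm t hA.1 hB.1 X := by
    rw [h3, mul_smul_comm, trace_smul, Complex.real_smul, Complex.re_ofReal_mul]
  rw [re_trace_conjTranspose_mul_sylvester, h8] at h4
  simp only [conjTranspose_smul, star_trivial, smul_mul_assoc, mul_smul_comm, trace_smul,
    Complex.real_smul, Complex.re_ofReal_mul] at h4
  have h9 : t * (B' * (Yᴴ * Y)).trace.re ≤ t * (κ * (B * (Yᴴ * Y)).trace.re) :=
    mul_le_mul_of_nonneg_left h7 ht.le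
  have h10 : κ⁻¹ * (κ⁻¹ * ((A' * (Y * Yᴴ)).trace.re + t * (B' * (Yᴴ * Y)).trace.re)) ≤
      κ⁻¹ * (κ⁻¹ * (κ * resolventForm t hA.1 hB.1 X)) := by
    have : 0 < κ⁻¹ := inv_pos.2 hκ
    gcongr
    rw [h5]
    linarith
  rw [inv_mul_cancel_left₀ hκ.ne'] at h10
  rw [← inv_mul_le_iff₀ hκ]
  linarith

lemma eigenForm_logKernel_one_le_mul {A' B' : Matrix (Fin d) (Fin d) ℂ} (hA : A.PosDef)
    (hB : B.PosDef) (hA' : A'.PosDef) (hB' : B'.PosDef) {κ : ℝ} (hκ : 0 < κ)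
    (h1 : (κ • A - A').PosSemidef) (h2 : (κ • B - B').PosSemidef)
    (X : Matrix (Fin d) (Fin d) ℂ) :
    eigenForm (logKernel 1) hA.1 hB.1 X ≤ κ * eigenForm (logKernel 1) hA'.1 hB'.1 X :=
  eigenForm_logKernel_le le_rfl hA hB X κ hA' hB' X fun _ ht =>
    resolventForm_le_mul hA hB hA' hB' hκ h1 h2 ht X

/-- The relative entropy is convex in its second argument. -/
lemma relEnt_sum_le {ι : Type*} (s : Finset ι) (c : ι → ℝ) (hc : ∀ i ∈ s, 0 ≤ c i)
    (hc1 : ∑ i ∈ s, c i = 1) {ρ : Matrix (Fin d) (Fin d) ℂ} (hρ : ρ.PosDef)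
    {η : ι → Matrix (Fin d) (Fin d) ℂ} (hη : ∀ i, (η i).PosDef)
    (htr : ∀ i, (η i).trace = ρ.trace) (hη' : (∑ i ∈ s, c i • η i).PosDef) :
    relEnt ρ (∑ i ∈ s, c i • η i) ≤ ∑ i ∈ s, c i * relEnt ρ (η i) := by
  have htr' : ρ.trace = (∑ i ∈ s, c i • η i).trace := by
    simp only [trace_sum, trace_smul, htr, ← Finset.sum_smul, hc1, one_smul]
  rw [relEnt_eq_eigenForm hρ hη' htr']
  simp only [fun i => relEnt_eq_eigenForm hρ (hη i) (htr i).symm]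
  refine eigenForm_logKernel_le_sum one_le_two hη' hρ _ s c hη (fun _ => hρ) _ fun t ht => ?_
  set X := ∑ i ∈ s, c i • η i - ρ with hX
  obtain ⟨Y, hY⟩ := exists_sylvester hη' hρ ht X
  have h1 := resolventForm_sylvester hη' hρ ht hY
  have h2 := re_trace_conjTranspose_mul_sylvester (A := ∑ i ∈ s, c i • η i) (B := ρ) t Y
  rw [hY, ← re_trace_conjTranspose_mul_comm, ← h1] at h2
  have h3 : ∀ M : Matrix (Fin d) (Fin d) ℂ, (∑ i ∈ s, c i • M) = M := fun M => by
    rw [← Finset.sum_smul, hc1, one_smul]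
  have hXs : X = ∑ i ∈ s, c i • (η i - ρ) := by
    simp only [smul_sub, Finset.sum_sub_distrib, h3, hX]
  have h4 : (Xᴴ * Y).trace.re = ∑ i ∈ s, c i * ((η i - ρ)ᴴ * Y).trace.re := by
    rw [hXs]
    simp only [conjTranspose_sum, conjTranspose_smul, star_trivial, Finset.sum_mul,
      smul_mul_assoc, trace_sum, trace_smul, Complex.re_sum, Complex.real_smul,
      Complex.re_ofReal_mul]
  have h5 : ((∑ i ∈ s, c i • η i) * (Y * Yᴴ)).trace.re =
      ∑ i ∈ s, c i * (η i * (Y * Yᴴ)).trace.re := by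
    simp only [Finset.sum_mul, smul_mul_assoc, trace_sum, trace_smul, Complex.re_sum,
      Complex.real_smul, Complex.re_ofReal_mul]
  have h6 : ∀ r : ℝ, r = ∑ i ∈ s, c i * r := fun r => by rw [← Finset.sum_mul, hc1, one_mul]
  calc resolventForm t hη'.1 hρ.1 X
      = 2 * (Xᴴ * Y).trace.re - (((∑ i ∈ s, c i • η i) * (Y * Yᴴ)).trace.re +
          t * (ρ * (Yᴴ * Y)).trace.re) := by rw [← h2, ← h1]; ring
    _ = ∑ i ∈ s, c i * (2 * ((η i - ρ)ᴴ * Y).trace.re - ((η i * (Y * Yᴴ)).trace.re +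
          t * (ρ * (Yᴴ * Y)).trace.re)) := by
        rw [h4, h5, h6 (t * (ρ * (Yᴴ * Y)).trace.re), ← Finset.sum_add_distrib, Finset.mul_sum,
          ← Finset.sum_sub_distrib]
        refine Finset.sum_congr rfl fun i _ => ?_
        rw [← h6]
        ring
    _ ≤ _ := by
        refine Finset.sum_le_sum fun i hi => mul_le_mul_of_nonneg_left ?_ (hc i hi)
        rw [← re_trace_conjTranspose_mul_sylvester]
        exact two_mul_re_trace_sub_le_resolventForm (hη i) hρ ht _ Y

end Variational

section Positivity

variable {d : ℕ} {A B : Matrix (Fin d) (Fin d) ℂ}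

lemma posSemidef_cfc (hA : A.IsHermitian) {f : ℝ → ℝ} (hf : ∀ i, 0 ≤ f (hA.eigenvalues i)) :
    (hA.cfc f).PosSemidef := by
  rw [IsHermitian.cfc, Unitary.conjStarAlgAut_apply]
  refine PosSemidef.mul_mul_conjTranspose_same (PosSemidef.diagonal fun i => ?_) _
  exact Complex.zero_le_real.2 (hf i)

lemma hermitian_cfc_sub (hA : A.IsHermitian) (f g : ℝ → ℝ) :
    hA.cfc (fun x => f x - g x) = hA.cfc f - hA.cfc g := by
  rw [IsHermitian.cfc, IsHermitian.cfc, IsHermitian.cfc, ← map_sub, diagonal_sub]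
  congr 2
  ext
  simp

lemma hermitian_cfc_add (hA : A.IsHermitian) (f g : ℝ → ℝ) :
    hA.cfc (fun x => f x + g x) = hA.cfc f + hA.cfc g := by
  rw [IsHermitian.cfc, IsHermitian.cfc, IsHermitian.cfc, ← map_add, diagonal_add]
  congr 2
  ext
  simp

lemma hermitian_cfc_const (hA : A.IsHermitian) (r : ℝ) : hA.cfc (fun _ => r) = r • 1 := by
  have h : (RCLike.ofReal ∘ (fun _ => r) ∘ hA.eigenvalues : Fin d → ℂ) = fun _ => (r : ℂ) := by
    ext; simp
  rw [IsHermitian.cfc, h, ← smul_one_eq_diagonal, map_smul, map_one]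
  rfl

lemma isHermitian_cfc (hA : A.IsHermitian) (f : ℝ → ℝ) : (hA.cfc f).IsHermitian := by
  rw [IsHermitian.cfc, Unitary.conjStarAlgAut_apply]
  refine isHermitian_mul_mul_conjTranspose _ (isHermitian_diagonal_of_self_adjoint _ ?_)
  ext i
  simp

lemma trace_cfc (hA : A.IsHermitian) (f : ℝ → ℝ) :
    (hA.cfc f).trace.re = ∑ i, f (hA.eigenvalues i) := by
  rw [IsHermitian.cfc, Unitary.conjStarAlgAut_apply, trace_mul_cycle,
    Unitary.coe_star_mul_self, one_mul, trace_diagonal, Complex.re_sum]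
  rfl

lemma exists_smul_one_le (hA : A.PosDef) : ∃ ε : ℝ, 0 < ε ∧ (A - ε • 1).PosSemidef := by
  have hs : ∀ i, (hA.1.eigenvalues i)⁻¹ ≤ 1 + ∑ j, (hA.1.eigenvalues j)⁻¹ := fun i =>
    (Finset.single_le_sum (f := fun j => (hA.1.eigenvalues j)⁻¹)
      (fun j _ => (inv_pos.2 (hA.eigenvalues_pos j)).le) (Finset.mem_univ i)).trans
      (le_add_of_nonneg_left zero_le_one)
  have h0 : 0 < 1 + ∑ j, (hA.1.eigenvalues j)⁻¹ :=
    add_pos_of_pos_of_nonneg one_pos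
      (Finset.sum_nonneg fun j _ => (inv_pos.2 (hA.eigenvalues_pos j)).le)
  refine ⟨(1 + ∑ j, (hA.1.eigenvalues j)⁻¹)⁻¹, inv_pos.2 h0, ?_⟩
  have h := posSemidef_cfc hA.1 (f := fun x => id x - (1 + ∑ j, (hA.1.eigenvalues j)⁻¹)⁻¹)
    fun i => sub_nonneg.2 (inv_le_of_inv_le₀ (hA.eigenvalues_pos i) (hs i))
  rwa [hermitian_cfc_sub, cfc_id_eq, hermitian_cfc_const] at h

lemma exists_le_smul_one (hA : A.IsHermitian) : ∃ Λ : ℝ, 0 < Λ ∧ (Λ • 1 - A).PosSemidef := by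
  have h0 : 0 ≤ ∑ j, |hA.eigenvalues j| := Finset.sum_nonneg fun j _ => abs_nonneg _
  refine ⟨1 + ∑ j, |hA.eigenvalues j|, by positivity, ?_⟩
  have h := posSemidef_cfc hA (f := fun x => (1 + ∑ j, |hA.eigenvalues j|) - id x)
    fun i => sub_nonneg.2 ?_
  · rwa [hermitian_cfc_sub, cfc_id_eq, hermitian_cfc_const] at h
  · have := Finset.single_le_sum (f := fun j => |hA.eigenvalues j|)
      (fun j _ => abs_nonneg _) (Finset.mem_univ i)
    have := le_abs_self (hA.eigenvalues i)
    simp only [id] at *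
    linarith

lemma exists_smul_le (hA : A.PosDef) (hB : B.IsHermitian) :
    ∃ ε ∈ Set.Ioo (0 : ℝ) 1, (A - ε • B).PosSemidef := by
  obtain ⟨ε, hε, h1⟩ := exists_smul_one_le hA
  obtain ⟨Λ, hΛ, h2⟩ := exists_le_smul_one hB
  obtain ⟨δ, hδ0, hδ⟩ : ∃ δ : ℝ, 0 < δ ∧ δ < min 1 (ε / Λ) :=
    exists_between (lt_min one_pos (div_pos hε hΛ))
  have hδΛ : δ * Λ < ε := (lt_div_iff₀ hΛ).1 (hδ.trans_le (min_le_right _ _))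
  refine ⟨δ, ⟨hδ0, hδ.trans_le (min_le_left _ _)⟩, ?_⟩
  have h3 := (h1.add (h2.smul hδ0.le)).add
    ((PosSemidef.one (n := Fin d) (R := ℂ)).smul (sub_nonneg.2 hδΛ.le))
  convert h3 using 1
  module

lemma posDef_of_smul_one_le {ε : ℝ} (hε : 0 < ε) (h : (A - ε • 1).PosSemidef) : A.PosDef := by
  have h1 := (PosDef.one (n := Fin d) (R := ℂ)).smul hε |>.add_posSemidef h
  rwa [add_sub_cancel] at h1

/-- Positive unital maps preserve positive definiteness. -/
lemma posDef_map {T : Matrix (Fin d) (Fin d) ℂ →ₗ[ℂ] Matrix (Fin d) (Fin d) ℂ}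
    (hT : ∀ X, X.PosSemidef → (T X).PosSemidef) (hT1 : T 1 = 1) (hA : A.PosDef) :
    (T A).PosDef := by
  obtain ⟨ε, hε, h⟩ := exists_smul_one_le hA
  have h1 := hT _ h
  rw [map_sub, LinearMap.map_smul_of_tower, hT1] at h1
  exact posDef_of_smul_one_le hε h1

end Positivity

section ConditionalExpectation

variable {d : ℕ}

/-- `E` is the Hilbert–Schmidt orthogonal projection onto the unital *-subalgebra `N`. -/
structure IsCondExp (N : StarSubalgebra ℂ (Matrix (Fin d) (Fin d) ℂ))
    (E : Matrix (Fin d) (Fin d) ℂ →ₗ[ℂ] Matrix (Fin d) (Fin d) ℂ) : Prop where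
  map_mem : ∀ X, E X ∈ N
  map_of_mem : ∀ X ∈ N, E X = X
  trace_conjTranspose_mul_sub : ∀ X, ∀ Y ∈ N, (Yᴴ * (X - E X)).trace = 0

namespace IsCondExp

variable {N : StarSubalgebra ℂ (Matrix (Fin d) (Fin d) ℂ)}
  {E : Matrix (Fin d) (Fin d) ℂ →ₗ[ℂ] Matrix (Fin d) (Fin d) ℂ}
  {A X Y Z ρ σ τ : Matrix (Fin d) (Fin d) ℂ}

lemma trace_mul (h : IsCondExp N E) (X : Matrix (Fin d) (Fin d) ℂ) (hY : Y ∈ N) :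
    (Y * E X).trace = (Y * X).trace := by
  have := h.trace_conjTranspose_mul_sub X _ (star_mem hY)
  rw [star_eq_conjTranspose, conjTranspose_conjTranspose, mul_sub, trace_sub, sub_eq_zero] at this
  exact this.symm

lemma eq_of_trace_mul (h : IsCondExp N E) (hZ : Z ∈ N)
    (hXZ : ∀ Y ∈ N, (Y * X).trace = (Y * Z).trace) : E X = Z := by
  have hW : E X - Z ∈ N := sub_mem (h.map_mem X) hZ
  have h1 : ((E X - Z)ᴴ * (E X - Z)).trace = 0 := by
    rw [mul_sub, trace_sub, ← star_eq_conjTranspose, h.trace_mul X (star_mem hW),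
      hXZ _ (star_mem hW), sub_self]
  exact sub_eq_zero.1 (trace_conjTranspose_mul_self_eq_zero_iff.1 h1)

lemma map_conjTranspose (h : IsCondExp N E) (X : Matrix (Fin d) (Fin d) ℂ) :
    E Xᴴ = (E X)ᴴ := by
  refine h.eq_of_trace_mul (star_mem (h.map_mem X)) fun Y hY => ?_
  have h1 := congrArg star (h.trace_mul X (star_mem hY))
  rw [← trace_conjTranspose, ← trace_conjTranspose, conjTranspose_mul, conjTranspose_mul,
    star_eq_conjTranspose, conjTranspose_conjTranspose, trace_mul_comm, trace_mul_comm Xᴴ] at h1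
  exact h1.symm

lemma isHermitian (h : IsCondExp N E) (hX : X.IsHermitian) : (E X).IsHermitian := by
  rw [IsHermitian, ← h.map_conjTranspose, hX.eq]

lemma trace_map (h : IsCondExp N E) (X : Matrix (Fin d) (Fin d) ℂ) :
    (E X).trace = X.trace := by
  simpa using h.trace_mul X (one_mem N)

lemma map_one (h : IsCondExp N E) : E 1 = 1 := h.map_of_mem 1 (one_mem N)

lemma map_mul_left (h : IsCondExp N E) (hA : A ∈ N) (X : Matrix (Fin d) (Fin d) ℂ) :
    E (A * X) = A * E X :=
  h.eq_of_trace_mul (mul_mem hA (h.map_mem X)) fun Y hY => by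
    rw [← mul_assoc, ← mul_assoc, h.trace_mul X (mul_mem hY hA)]

lemma map_mul_right (h : IsCondExp N E) (hA : A ∈ N) (X : Matrix (Fin d) (Fin d) ℂ) :
    E (X * A) = E X * A :=
  h.eq_of_trace_mul (mul_mem (h.map_mem X) hA) fun Y hY => by
    rw [← mul_assoc, ← mul_assoc, trace_mul_comm, ← mul_assoc, ← h.trace_mul X (mul_mem hA hY),
      trace_mul_comm _ A, mul_assoc]

lemma real_smul_mem (r : ℝ) (hA : A ∈ N) : r • A ∈ N := by
  have := N.toSubalgebra.smul_mem hA (r : ℂ)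
  rwa [Complex.coe_smul] at this

lemma cfc_mem (hA : A.IsHermitian) (hAN : A ∈ N) (f : ℝ → ℝ) : hA.cfc f ∈ N := by
  have hpoly : ∀ p : Polynomial ℝ, hA.cfc (fun x => p.eval x) ∈ N := by
    intro p
    induction p using Polynomial.induction_on' with
    | add p q hp hq =>
      simp only [Polynomial.eval_add]
      rw [hermitian_cfc_add]
      exact add_mem hp hq
    | monomial n a =>
      simp only [Polynomial.eval_monomial]
      rw [← cfc_mul_cfc, hermitian_cfc_const]
      refine mul_mem (real_smul_mem a (one_mem N)) ?_
      induction n with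
      | zero => simp [cfc_one_eq]
      | succ n ih =>
        simp only [pow_succ]
        rw [← cfc_mul_cfc]
        refine mul_mem ih ?_
        change hA.cfc id ∈ N
        rwa [cfc_id_eq]
  have heq : hA.cfc f = hA.cfc (fun x =>
      (Lagrange.interpolate (Finset.univ.image hA.eigenvalues) id f).eval x) := by
    rw [IsHermitian.cfc, IsHermitian.cfc]
    congr 2
    ext i
    have := Lagrange.eval_interpolate_at_node (s := Finset.univ.image hA.eigenvalues) (v := id) f
      Function.injective_id.injOn (Finset.mem_image_of_mem _ (Finset.mem_univ i))
    rw [Function.comp, Function.comp, Function.comp, Function.comp, ← this]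
    rfl
  exact heq ▸ hpoly _

lemma matLog_mem (hA : A.IsHermitian) (hAN : A ∈ N) : matLog A ∈ N := by
  rw [matLog_eq hA]
  exact cfc_mem hA hAN _

lemma posSemidef (h : IsCondExp N E) (hX : X.PosSemidef) : (E X).PosSemidef := by
  have hH := h.isHermitian hX.1
  set g : ℝ → ℝ := fun x => if x < 0 then 1 else 0 with hg
  have h1 := cfc_mul_cfc hH (fun x => g x * g x) id
  rw [← cfc_mul_cfc hH g g, cfc_id_eq] at h1
  have h2 : 0 ≤ (hH.cfc (fun x => g x * g x * id x)).trace.re := by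
    have hm := cfc_mem hH (h.map_mem X) g
    have h3 := (hX.mul_mul_conjTranspose_same (hH.cfc g)).trace_nonneg
    rw [(isHermitian_cfc hH g).eq, trace_mul_comm, ← mul_assoc,
      ← h.trace_mul X (mul_mem hm hm), h1] at h3
    exact (Complex.le_def.1 h3).1
  rw [trace_cfc] at h2
  have h4 : ∀ x : ℝ, g x * g x * id x = min x 0 := by
    intro x
    simp only [hg, id]
    split_ifs with hx
    · simp [min_eq_left hx.le]
    · simp [min_eq_right (not_lt.1 hx)]
  simp only [h4] at h2
  rw [hH.posSemidef_iff_eigenvalues_nonneg]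
  intro i
  by_contra! hi
  have h5 := Finset.sum_lt_sum (s := Finset.univ) (f := fun i => min (hH.eigenvalues i) 0)
    (g := fun _ => (0 : ℝ)) (fun j _ => min_le_right _ _)
    ⟨i, Finset.mem_univ i, (min_le_left _ _).trans_lt hi⟩
  simp only [Finset.sum_const_zero] at h5
  linarith

lemma posDef (h : IsCondExp N E) (hX : X.PosDef) : (E X).PosDef :=
  posDef_map (fun _ => h.posSemidef) h.map_one hX

lemma resolventForm_map_le (h : IsCondExp N E) (hρ : ρ.PosDef) (hσ : σ.PosDef) {t : ℝ}
    (ht : 0 < t) (X : Matrix (Fin d) (Fin d) ℂ) :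
    resolventForm t (h.posDef hσ).1 (h.posDef hρ).1 (E X) ≤ resolventForm t hσ.1 hρ.1 X := by
  obtain ⟨Y, hY⟩ := exists_sylvester (h.posDef hσ) (h.posDef hρ) ht (E X)
  have hEY : E σ * E Y + t • (E Y * E ρ) = E X := by
    have h1 := congrArg E hY
    rwa [map_add, LinearMap.map_smul_of_tower, h.map_mul_left (h.map_mem σ),
      h.map_mul_right (h.map_mem ρ), h.map_of_mem _ (h.map_mem X)] at h1
  have hm := h.map_mem Y
  have hm' : (E Y)ᴴ ∈ N := star_mem hm
  have h1 := resolventForm_sylvester (h.posDef hσ) (h.posDef hρ) ht hEY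
  have h2 := two_mul_re_trace_sub_le_resolventForm hσ hρ ht X (E Y)
  have h3 := re_trace_conjTranspose_mul_sylvester (A := E σ) (B := E ρ) t (E Y)
  rw [hEY, ← re_trace_conjTranspose_mul_comm, ← h1, trace_mul_comm,
    h.trace_mul σ (mul_mem hm hm'), trace_mul_comm, trace_mul_comm (E ρ),
    h.trace_mul ρ (mul_mem hm' hm), trace_mul_comm _ ρ, ← re_trace_conjTranspose_mul_sylvester]
    at h3
  rw [re_trace_conjTranspose_mul_comm, h.trace_mul X hm', ← re_trace_conjTranspose_mul_comm] at h1
  linarith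

lemma relEnt_map_le (h : IsCondExp N E) (hρ : ρ.PosDef) (hσ : σ.PosDef)
    (htr : ρ.trace = σ.trace) : relEnt (E ρ) (E σ) ≤ relEnt ρ σ := by
  rw [relEnt_eq_eigenForm (h.posDef hρ) (h.posDef hσ) (by rw [h.trace_map, h.trace_map, htr]),
    relEnt_eq_eigenForm hρ hσ htr, ← map_sub, ← one_mul (eigenForm _ hσ.1 _ _)]
  refine eigenForm_logKernel_le one_le_two (h.posDef hσ) (h.posDef hρ) _ 1 hσ hρ _ fun t ht => ?_
  rw [one_mul]
  exact h.resolventForm_map_le hρ hσ ht _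

lemma trace_map_mul_matLog (h : IsCondExp N E) (hA : A.IsHermitian) (hAN : A ∈ N) :
    (E ρ * matLog A).trace = (ρ * matLog A).trace := by
  rw [trace_mul_comm, h.trace_mul ρ (matLog_mem hA hAN), trace_mul_comm]

lemma relEnt_le_add (h : IsCondExp N E) (hρ : ρ.PosDef) (hτ : τ.PosDef)
    (htr : ρ.trace = τ.trace) : relEnt ρ (E τ) ≤ relEnt ρ (E ρ) + relEnt ρ τ := by
  have h1 := h.relEnt_map_le hρ hτ htr
  have h2 := h.trace_map_mul_matLog (ρ := ρ) (h.posDef hτ).1 (h.map_mem τ)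
  have h3 := h.trace_map_mul_matLog (ρ := ρ) (h.posDef hρ).1 (h.map_mem ρ)
  simp only [relEnt_eq, h2, h3] at h1 ⊢
  linarith

end IsCondExp

section Composition

variable {J : ℕ} {Ns : Fin J → StarSubalgebra ℂ (Matrix (Fin d) (Fin d) ℂ)}
  {Es : Fin J → (Matrix (Fin d) (Fin d) ℂ →ₗ[ℂ] Matrix (Fin d) (Fin d) ℂ)}
  {ρ : Matrix (Fin d) (Fin d) ℂ}

lemma compSeq_cons (j : Fin J) (s : List (Fin J)) (X : Matrix (Fin d) (Fin d) ℂ) :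
    compSeq Es (j :: s) X = Es j (compSeq Es s X) := rfl

lemma posDef_compSeq (hE : ∀ j, IsCondExp (Ns j) (Es j)) (hρ : ρ.PosDef) (s : List (Fin J)) :
    (compSeq Es s ρ).PosDef := by
  induction s with
  | nil => exact hρ
  | cons j s ih => exact (hE j).posDef ih

lemma trace_compSeq (hE : ∀ j, IsCondExp (Ns j) (Es j)) (X : Matrix (Fin d) (Fin d) ℂ)
    (s : List (Fin J)) : (compSeq Es s X).trace = X.trace := by
  induction s with
  | nil => rfl
  | cons j s ih => rw [compSeq_cons, (hE j).trace_map, ih]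

lemma compSeq_one (hE : ∀ j, IsCondExp (Ns j) (Es j)) (s : List (Fin J)) :
    compSeq Es s 1 = 1 := by
  induction s with
  | nil => rfl
  | cons j s ih => rw [compSeq_cons, ih, (hE j).map_one]

lemma map_compSeq (hE : ∀ j, IsCondExp (Ns j) (Es j))
    {E : Matrix (Fin d) (Fin d) ℂ →ₗ[ℂ] Matrix (Fin d) (Fin d) ℂ} (h : IsCondExp (⨅ j, Ns j) E)
    (X : Matrix (Fin d) (Fin d) ℂ) (s : List (Fin J)) : E (compSeq Es s X) = E X := by
  induction s with
  | nil => rfl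
  | cons j s ih =>
    rw [← ih, compSeq_cons]
    refine h.eq_of_trace_mul (h.map_mem _) fun Y hY => ?_
    rw [h.trace_mul _ hY, (hE j).trace_mul _ (iInf_le Ns j hY)]

lemma relEnt_compSeq_le (hE : ∀ j, IsCondExp (Ns j) (Es j)) (hρ : ρ.PosDef)
    (s : List (Fin J)) :
    relEnt ρ (compSeq Es s ρ) ≤ ∑ j, (s.count j : ℝ) * relEnt ρ (Es j ρ) := by
  induction s with
  | nil => simp [relEnt, compSeq]
  | cons i s ih =>
    have h := (hE i).relEnt_le_add hρ (posDef_compSeq hE hρ s) (trace_compSeq hE ρ s).symm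
    have h1 : ∑ j, ((i :: s).count j : ℝ) * relEnt ρ (Es j ρ) =
        relEnt ρ (Es i ρ) + ∑ j, (s.count j : ℝ) * relEnt ρ (Es j ρ) := by
      simp [List.count_cons, add_mul, Finset.sum_add_distrib, add_comm]
    rw [compSeq_cons, h1]
    linarith

end Composition

end ConditionalExpectation

section DoublyStochastic

variable {d : ℕ} {A B P : Matrix (Fin d) (Fin d) ℂ}

/-- The spectral projection of `A` onto the line spanned by its `i`-th eigenvector. -/
noncomputable def eigenProj (hA : A.IsHermitian) (i : Fin d) : Matrix (Fin d) (Fin d) ℂ :=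
  Unitary.conjStarAlgAut ℂ _ hA.eigenvectorUnitary (diagonal (Pi.single i 1))

lemma posSemidef_eigenProj (hA : A.IsHermitian) (i : Fin d) : (eigenProj hA i).PosSemidef := by
  rw [eigenProj, Unitary.conjStarAlgAut_apply]
  refine PosSemidef.mul_mul_conjTranspose_same (PosSemidef.diagonal fun j => ?_) _
  by_cases h : j = i
  · subst h; simp
  · simp [h]

lemma sum_smul_eigenProj (hA : A.IsHermitian) : ∑ i, hA.eigenvalues i • eigenProj hA i = A := by
  have h : ∀ i, hA.eigenvalues i • eigenProj hA i =
      Unitary.conjStarAlgAut ℂ _ hA.eigenvectorUnitary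
        (diagonal (Pi.single i (hA.eigenvalues i : ℂ))) := by
    intro i
    rw [eigenProj, ← Complex.coe_smul, ← map_smul, ← diagonal_smul, ← Pi.single_smul, smul_eq_mul,
      mul_one]
  conv_rhs => rw [hA.spectral_theorem]
  simp only [h]
  rw [← map_sum]
  congr 1
  ext j k
  by_cases hjk : j = k
  · subst hjk; simp [Matrix.sum_apply, Pi.single_apply]
  · simp [Matrix.sum_apply, hjk]

lemma sum_eigenProj (hA : A.IsHermitian) : ∑ i, eigenProj hA i = 1 := by
  simp only [eigenProj]
  rw [← map_sum, ← map_one (Unitary.conjStarAlgAut ℂ _ hA.eigenvectorUnitary)]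
  congr 1
  ext j k
  by_cases hjk : j = k
  · subst hjk; simp [Matrix.sum_apply, Pi.single_apply]
  · simp [Matrix.sum_apply, hjk]

lemma trace_eigenProj (hA : A.IsHermitian) (i : Fin d) : (eigenProj hA i).trace = 1 := by
  rw [eigenProj, Unitary.conjStarAlgAut_apply, trace_mul_cycle, Unitary.coe_star_mul_self, one_mul,
    trace_diagonal]
  simp

lemma trace_eigenProj_mul (hA : A.IsHermitian) (i : Fin d) :
    (eigenProj hA i * A).trace = hA.eigenvalues i := by
  have h : eigenProj hA i * hA.cfc id = (hA.eigenvalues i : ℂ) • eigenProj hA i := by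
    rw [eigenProj, IsHermitian.cfc, ← map_mul, ← map_smul, diagonal_mul_diagonal, ← diagonal_smul]
    congr 2
    ext j
    by_cases hj : j = i
    · subst hj; simp
    · simp [hj]
  rw [cfc_id_eq] at h
  rw [h, trace_smul, trace_eigenProj, smul_eq_mul, mul_one]

lemma re_trace_mul_nonneg (hA : A.PosSemidef) (hP : P.PosSemidef) : 0 ≤ (A * P).trace.re := by
  simpa using re_trace_mul_le (A := 0) (B := A) (κ := 1) (by simpa using hA) hP

/-- Positive, trace-preserving, unital maps do not decrease the von Neumann entropy. -/
lemma re_trace_mul_matLog_map_le {T : Matrix (Fin d) (Fin d) ℂ →ₗ[ℂ] Matrix (Fin d) (Fin d) ℂ}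
    (hT : ∀ X, X.PosSemidef → (T X).PosSemidef) (hTtr : ∀ X, (T X).trace = X.trace)
    (hT1 : T 1 = 1) (hA : A.PosSemidef) :
    (T A * matLog (T A)).trace.re ≤ (A * matLog A).trace.re := by
  have hB := hT A hA
  rw [mul_matLog hA.1, mul_matLog hB.1, trace_cfc, trace_cfc]
  set D : Fin d → Fin d → ℝ := fun i j =>
    (eigenProj hB.1 i * T (eigenProj hA.1 j)).trace.re with hD
  have hD0 : ∀ i j, 0 ≤ D i j := fun i j =>
    re_trace_mul_nonneg (posSemidef_eigenProj _ i) (hT _ (posSemidef_eigenProj _ j))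
  have hDr : ∀ i, ∑ j, D i j = 1 := by
    intro i
    simp only [hD]
    rw [← Complex.re_sum, ← trace_sum, ← Finset.mul_sum, ← map_sum, sum_eigenProj, hT1, mul_one,
      trace_eigenProj, Complex.one_re]
  have hDc : ∀ j, ∑ i, D i j = 1 := by
    intro j
    simp only [hD]
    rw [← Complex.re_sum, ← trace_sum, ← Finset.sum_mul, sum_eigenProj, one_mul, hTtr,
      trace_eigenProj, Complex.one_re]
  have hDe : ∀ i, ∑ j, D i j • hA.1.eigenvalues j = hB.1.eigenvalues i := by
    intro i
    have h : T A = ∑ j, hA.1.eigenvalues j • T (eigenProj hA.1 j) := by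
      conv_lhs => rw [← sum_smul_eigenProj hA.1]
      simp only [map_sum, LinearMap.map_smul_of_tower]
    have h1 : ∀ M, M = T A → (eigenProj hB.1 i * M).trace.re = hB.1.eigenvalues i := by
      rintro M rfl
      rw [trace_eigenProj_mul, Complex.ofReal_re]
    rw [← h1 _ h.symm, Finset.mul_sum, trace_sum, Complex.re_sum]
    refine Finset.sum_congr rfl fun j _ => ?_
    rw [mul_smul_comm, trace_smul, Complex.smul_re, smul_eq_mul, smul_eq_mul, mul_comm]
  calc ∑ i, hB.1.eigenvalues i * Real.log (hB.1.eigenvalues i)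
      ≤ ∑ i, ∑ j, D i j • (hA.1.eigenvalues j * Real.log (hA.1.eigenvalues j)) := by
        refine Finset.sum_le_sum fun i _ => ?_
        rw [← hDe]
        exact Real.convexOn_mul_log.map_sum_le (fun j _ => hD0 i j) (hDr i)
          fun j _ => hA.eigenvalues_nonneg j
    _ = _ := by
        rw [Finset.sum_comm]
        refine Finset.sum_congr rfl fun j _ => ?_
        rw [← Finset.sum_smul, hDc, one_smul]

end DoublyStochastic

section BregmanPath

open Filter Topology

/-- If the decrease of `f` over an interval is at most quadratic in its length, then `f` is
nondecreasing. -/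
lemma le_of_forall_neg_sq_le {f : ℝ → ℝ} {C : ℝ}
    (h : ∀ x y, 0 ≤ x → x ≤ y → y ≤ 1 → -(C * (y - x) ^ 2) ≤ f y - f x) {x y : ℝ} (hx : 0 ≤ x)
    (hxy : x ≤ y) (hy : y ≤ 1) : f x ≤ f y := by
  have key : ∀ n : ℕ, ∀ x y, 0 ≤ x → x ≤ y → y ≤ 1 →
      -(C * (1 / 2) ^ n * (y - x) ^ 2) ≤ f y - f x := by
    intro n
    induction n with
    | zero => simpa using h
    | succ n ih =>
      intro x y hx hxy hy
      have h1 := ih x ((x + y) / 2) hx (by linarith) (by linarith)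
      have h2 := ih ((x + y) / 2) y (by linarith) (by linarith) hy
      have h3 : C * (1 / 2) ^ (n + 1) * (y - x) ^ 2 = C * (1 / 2) ^ n * ((x + y) / 2 - x) ^ 2 +
          C * (1 / 2) ^ n * (y - (x + y) / 2) ^ 2 := by ring
      linarith
  have hlim : Tendsto (fun n : ℕ => -(C * (1 / 2 : ℝ) ^ n * (y - x) ^ 2)) atTop (𝓝 0) := by
    have := (((tendsto_pow_atTop_nhds_zero_of_lt_one (r := (1 / 2 : ℝ)) (by norm_num)
      (by norm_num)).const_mul C).mul_const ((y - x) ^ 2)).neg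
    simpa using this
  exact sub_nonneg.1 (le_of_tendsto' hlim fun n => key n x y hx hxy hy)

/-- `F` is a convex function on `[0, 1]` with subgradient `a`, normalized to vanish to first order
at `0`. -/
structure IsBregmanPath (F a : ℝ → ℝ) : Prop where
  map_zero : F 0 = 0
  slope_zero : a 0 = 0
  le_sub : ∀ x y, 0 ≤ x → x ≤ y → y ≤ 1 → (y - x) * a x ≤ F y - F x
  sub_le : ∀ x y, 0 ≤ x → x ≤ y → y ≤ 1 → F y - F x ≤ (y - x) * a y

lemma IsBregmanPath.compare {F₁ a₁ F₂ a₂ F₃ a₃ : ℝ → ℝ} (h₁ : IsBregmanPath F₁ a₁)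
    (h₂ : IsBregmanPath F₂ a₂) (h₃ : IsBregmanPath F₃ a₃) {α β C C' : ℝ} (hα : 0 ≤ α)
    (hβ : 0 ≤ β)
    (h : ∀ x y, 0 ≤ x → x ≤ y → y ≤ 1 →
      α * (a₂ y - a₂ x) - β * (a₃ y - a₃ x) - C * (y - x) ^ 2 ≤ a₁ y - a₁ x)
    (h' : ∀ x y, 0 ≤ x → x ≤ y → y ≤ 1 → a₂ y - a₂ x ≤ C' * (y - x)) :
    α * F₂ 1 - β * F₃ 1 ≤ F₁ 1 := by
  have hg : ∀ x, 0 ≤ x → x ≤ 1 → 0 ≤ a₁ x - α * a₂ x + β * a₃ x := by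
    intro x hx hx1
    have := le_of_forall_neg_sq_le (f := fun x => a₁ x - α * a₂ x + β * a₃ x) (C := C)
      (fun x y hx hxy hy => by have := h x y hx hxy hy; linarith) le_rfl hx hx1
    simpa [h₁.slope_zero, h₂.slope_zero, h₃.slope_zero] using this
  have hG := le_of_forall_neg_sq_le (f := fun x => F₁ x - α * F₂ x + β * F₃ x) (C := α * C')
    (fun x y hx hxy hy => by
      have e1 := h₁.le_sub x y hx hxy hy
      have e2 := mul_le_mul_of_nonneg_left (h₂.sub_le x y hx hxy hy) hα
      have e3 := mul_le_mul_of_nonneg_left (h₃.le_sub x y hx hxy hy) hβ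
      have e4 := mul_nonneg (sub_nonneg.2 hxy) (hg x hx (hxy.trans hy))
      have e5 := mul_le_mul_of_nonneg_left (h' x y hx hxy hy) (mul_nonneg hα (sub_nonneg.2 hxy))
      linarith) le_rfl zero_le_one le_rfl
  simp only [h₁.map_zero, h₂.map_zero, h₃.map_zero] at hG
  linarith

lemma one_add_mul_sub_one_pos {r t : ℝ} (hr : 0 < r) (ht : 0 ≤ t) (ht1 : t ≤ 1) :
    0 < 1 + t * (r - 1) := by
  rcases le_total r 1 with h | h
  · nlinarith
  · nlinarith

lemma log_sub_log_le {u v : ℝ} (hu : 0 < u) (hv : 0 < v) :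
    Real.log v - Real.log u ≤ (v - u) / u := by
  rw [← Real.log_div hv.ne' hu.ne', sub_div, div_self hu.ne']
  exact Real.log_le_sub_one_of_pos (div_pos hv hu)

lemma isBregmanPath_mul_log {r : ℝ} (hr : 0 < r) :
    IsBregmanPath (fun t => (1 + t * (r - 1)) * Real.log (1 + t * (r - 1)) - t * (r - 1))
      (fun t => (r - 1) * Real.log (1 + t * (r - 1))) where
  map_zero := by simp
  slope_zero := by simp
  le_sub x y hx hxy hy := by
    have hu := one_add_mul_sub_one_pos hr hx (hxy.trans hy)
    have hv := one_add_mul_sub_one_pos hr (hx.trans hxy) hy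
    have h := log_sub_log_le hv hu
    rw [le_div_iff₀ hv] at h
    linarith
  sub_le x y hx hxy hy := by
    have hu := one_add_mul_sub_one_pos hr hx (hxy.trans hy)
    have hv := one_add_mul_sub_one_pos hr (hx.trans hxy) hy
    have h := log_sub_log_le hu hv
    rw [le_div_iff₀ hu] at h
    linarith

variable {d : ℕ} {ρ σ : Matrix (Fin d) (Fin d) ℂ}

lemma posDef_segment (hσ : σ.PosDef) (hρ : ρ.PosDef) {t : ℝ} (ht : 0 ≤ t) (ht1 : t ≤ 1) :
    (σ + t • (ρ - σ)).PosDef := by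
  have e : σ + t • (ρ - σ) = (1 - t) • σ + t • ρ := by module
  rw [e]
  rcases ht.eq_or_lt with rfl | h
  · simpa using hσ
  · exact (hρ.smul h).posSemidef_add (hσ.posSemidef.smul (sub_nonneg.2 ht1))

lemma trace_segment (htr : ρ.trace = σ.trace) (t : ℝ) :
    (σ + t • (ρ - σ)).trace = σ.trace := by
  rw [trace_add, trace_smul, trace_sub, htr, sub_self, smul_zero, add_zero]

lemma relEnt_sub_relEnt (ρ σ τ : Matrix (Fin d) (Fin d) ℂ) :
    relEnt ρ τ - relEnt σ τ = relEnt ρ σ + ((ρ - σ) * (matLog σ - matLog τ)).trace.re := by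
  simp only [relEnt, sub_mul, mul_sub, trace_sub, Complex.sub_re]
  ring

lemma segment_sub_segment (σ ρ : Matrix (Fin d) (Fin d) ℂ) (x y : ℝ) :
    (σ + y • (ρ - σ)) - (σ + x • (ρ - σ)) = (y - x) • (ρ - σ) := by
  module

/-- The directional derivative of `τ ↦ D(τ‖σ)` at the point `σ + t (ρ - σ)` towards `ρ`. -/
noncomputable def relEntSlope (σ ρ : Matrix (Fin d) (Fin d) ℂ) (t : ℝ) : ℝ :=
  ((ρ - σ) * (matLog (σ + t • (ρ - σ)) - matLog σ)).trace.re

lemma isBregmanPath_relEnt (hσ : σ.PosDef) (hρ : ρ.PosDef) (htr : ρ.trace = σ.trace) :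
    IsBregmanPath (fun t => relEnt (σ + t • (ρ - σ)) σ) (relEntSlope σ ρ) where
  map_zero := by simp [relEnt]
  slope_zero := by simp [relEntSlope]
  le_sub x y hx hxy hy := by
    have h := relEnt_nonneg (posDef_segment hσ hρ (hx.trans hxy) hy)
      (posDef_segment hσ hρ hx (hxy.trans hy)) (by rw [trace_segment htr, trace_segment htr])
    rw [relEnt_sub_relEnt, segment_sub_segment, smul_mul_assoc, trace_smul, Complex.smul_re,
      smul_eq_mul, relEntSlope]
    linarith
  sub_le x y hx hxy hy := by
    have h := relEnt_nonneg (posDef_segment hσ hρ hx (hxy.trans hy))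
      (posDef_segment hσ hρ (hx.trans hxy) hy) (by rw [trace_segment htr, trace_segment htr])
    rw [← neg_sub (relEnt _ _), relEnt_sub_relEnt, segment_sub_segment, smul_mul_assoc, trace_smul,
      Complex.smul_re, smul_eq_mul, relEntSlope]
    linarith

lemma relEntSlope_sub (hσ : σ.PosDef) (hρ : ρ.PosDef) {x y : ℝ} (hx : 0 ≤ x) (hxy : x ≤ y)
    (hy : y ≤ 1) : relEntSlope σ ρ y - relEntSlope σ ρ x =
      (y - x) * eigenForm (logKernel 1) (posDef_segment hσ hρ (hx.trans hxy) hy).1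
        (posDef_segment hσ hρ hx (hxy.trans hy)).1 (ρ - σ) := by
  rcases hxy.eq_or_lt with rfl | h
  · simp
  have h1 := re_trace_sub_mul_matLog_sub (posDef_segment hσ hρ (hx.trans hxy) hy)
    (posDef_segment hσ hρ hx (hxy.trans hy))
  simp only [segment_sub_segment] at h1
  rw [eigenForm_smul, smul_mul_assoc, trace_smul, Complex.smul_re, smul_eq_mul, sq, mul_assoc] at h1
  rw [← mul_left_cancel₀ (sub_pos.2 h).ne' h1, relEntSlope, relEntSlope]
  simp only [mul_sub, trace_sub, Complex.sub_re]
  ring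

end BregmanPath

section EntropyBounds

variable {d : ℕ} {ρ σ ω : Matrix (Fin d) (Fin d) ℂ}

lemma eigenForm_logKernel_one_nonneg (hσ : σ.PosDef) (hρ : ρ.PosDef)
    (X : Matrix (Fin d) (Fin d) ℂ) : 0 ≤ eigenForm (logKernel 1) hσ.1 hρ.1 X :=
  eigenForm_nonneg hσ hρ X fun _ _ => logKernel_nonneg 1

lemma eigenForm_logKernel_one_le_mul_segment {c : ℝ} (hc : 1 ≤ c) (hσ : σ.PosDef)
    (hω : ω.PosDef) (hdom : (c • σ - ω).PosSemidef) (X : Matrix (Fin d) (Fin d) ℂ) {x y : ℝ}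
    (hx : 0 ≤ x) (hxy : x ≤ y) (hy : y ≤ 1) :
    eigenForm (logKernel 1) hσ.1 hσ.1 X ≤ (1 + y * (c - 1)) *
      eigenForm (logKernel 1) (posDef_segment hσ hω (hx.trans hxy) hy).1
        (posDef_segment hσ hω hx (hxy.trans hy)).1 X := by
  refine eigenForm_logKernel_one_le_mul hσ hσ (posDef_segment hσ hω (hx.trans hxy) hy)
    (posDef_segment hσ hω hx (hxy.trans hy))
    (one_add_mul_sub_one_pos (by linarith) (hx.trans hxy) hy) ?_ ?_ X
  · convert hdom.smul (hx.trans hxy) using 1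
    module
  · convert (hdom.smul hx).add (hσ.posSemidef.smul
      (mul_nonneg (sub_nonneg.2 hxy) (sub_nonneg.2 hc))) using 1
    module

lemma mul_eigenForm_logKernel_one_segment_le {ε : ℝ} (hε : ε ∈ Set.Ioo (0 : ℝ) 1)
    (hσ : σ.PosDef) (hρ : ρ.PosDef) (hdom : (ρ - ε • σ).PosSemidef)
    (X : Matrix (Fin d) (Fin d) ℂ) {x y : ℝ} (hx : 0 ≤ x) (hxy : x ≤ y) (hy : y ≤ 1) :
    (1 + y * (ε - 1)) * eigenForm (logKernel 1) (posDef_segment hσ hρ (hx.trans hxy) hy).1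
      (posDef_segment hσ hρ hx (hxy.trans hy)).1 X ≤ eigenForm (logKernel 1) hσ.1 hσ.1 X := by
  have hκ := one_add_mul_sub_one_pos hε.1 (hx.trans hxy) hy
  rw [← le_inv_mul_iff₀ hκ]
  refine eigenForm_logKernel_one_le_mul (posDef_segment hσ hρ (hx.trans hxy) hy)
    (posDef_segment hσ hρ hx (hxy.trans hy)) hσ hσ (inv_pos.2 hκ) ?_ ?_ X
  · have h := (hdom.smul (hx.trans hxy)).smul (inv_pos.2 hκ).le
    have e : y • (ρ - ε • σ) = (σ + y • (ρ - σ)) - (1 + y * (ε - 1)) • σ := by module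
    rwa [e, smul_sub, inv_smul_smul₀ hκ.ne'] at h
  · have h := ((hdom.smul hx).add (hσ.posSemidef.smul
      (mul_nonneg (sub_nonneg.2 hxy) (sub_nonneg.2 hε.2.le)))).smul (inv_pos.2 hκ).le
    have e : x • (ρ - ε • σ) + ((y - x) * (1 - ε)) • σ =
      (σ + x • (ρ - σ)) - (1 + y * (ε - 1)) • σ := by module
    rwa [e, smul_sub, inv_smul_smul₀ hκ.ne'] at h

lemma log_sub_log_one_add_mul_le {r x y : ℝ} (hr : 0 < r) (hx : 0 ≤ x) (hxy : x ≤ y)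
    (hy : y ≤ 1) : Real.log (1 + y * (r - 1)) - Real.log (1 + x * (r - 1)) ≤
      (r - 1) * ((y - x) * (1 + x * (r - 1))⁻¹) := by
  refine (log_sub_log_le (one_add_mul_sub_one_pos hr hx (hxy.trans hy))
    (one_add_mul_sub_one_pos hr (hx.trans hxy) hy)).trans_eq ?_
  rw [div_eq_mul_inv]
  ring

lemma inv_one_add_mul_sub_inv {r x y : ℝ} (hr : 0 < r) (hx : 0 ≤ x) (hxy : x ≤ y)
    (hy : y ≤ 1) : (1 + x * (r - 1))⁻¹ - (1 + y * (r - 1))⁻¹ =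
      (r - 1) * (y - x) * ((1 + x * (r - 1))⁻¹ * (1 + y * (r - 1))⁻¹) := by
  have h1 := (one_add_mul_sub_one_pos hr hx (hxy.trans hy)).ne'
  have h2 := (one_add_mul_sub_one_pos hr (hx.trans hxy) hy).ne'
  rw [inv_sub_inv h1 h2, div_eq_mul_inv, mul_inv]
  ring

/-- A lower bound on the relative entropy by a quadratic form, under `ω ≤ c σ`. -/
lemma mul_eigenForm_logKernel_one_le_relEnt {c : ℝ} (hc : 1 < c) (hσ : σ.PosDef)
    (hω : ω.PosDef) (htr : ω.trace = σ.trace) (hdom : (c • σ - ω).PosSemidef) :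
    (c * Real.log c - (c - 1)) * eigenForm (logKernel 1) hσ.1 hσ.1 (ω - σ) ≤
      (c - 1) ^ 2 * relEnt ω σ := by
  set n := eigenForm (logKernel 1) hσ.1 hσ.1 (ω - σ) with hn
  have hn0 : 0 ≤ n := eigenForm_logKernel_one_nonneg hσ hσ _
  have hc0 : 0 < c - 1 := sub_pos.2 hc
  have hcp : 0 < c := zero_lt_one.trans hc
  have hlog : ∀ x y : ℝ, 0 ≤ x → x ≤ y → y ≤ 1 →
      (c - 1) * Real.log (1 + y * (c - 1)) - (c - 1) * Real.log (1 + x * (c - 1)) ≤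
        (c - 1) ^ 2 * ((y - x) * (1 + x * (c - 1))⁻¹) := fun x y hx hxy hy => by
    have := mul_le_mul_of_nonneg_left (log_sub_log_one_add_mul_le hcp hx hxy hy) hc0.le
    linarith
  have hinv : ∀ x : ℝ, 0 ≤ x → 0 ≤ (1 + x * (c - 1))⁻¹ ∧ (1 + x * (c - 1))⁻¹ ≤ 1 := fun x hx =>
    ⟨by positivity, inv_le_one_of_one_le₀ (le_add_of_nonneg_right (by positivity))⟩
  have hcmp := (isBregmanPath_relEnt hσ hω htr).compare
    (isBregmanPath_mul_log hcp) (isBregmanPath_mul_log one_pos)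
    (α := n / (c - 1) ^ 2) (β := 0) (C := n * (c - 1)) (C' := (c - 1) ^ 2) (by positivity) le_rfl
    (fun x y hx hxy hy => ?_) (fun x y hx hxy hy => ?_)
  · simp only [one_mul, zero_mul, sub_zero, one_smul, add_sub_cancel] at hcmp
    rw [div_mul_eq_mul_div, div_le_iff₀ (by positivity)] at hcmp
    linarith
  · have h1 := eigenForm_logKernel_one_le_mul_segment hc.le hσ hω hdom (ω - σ) hx hxy hy
    rw [← inv_mul_le_iff₀ (one_add_mul_sub_one_pos hcp (hx.trans hxy) hy), ← hn] at h1
    have h2 := mul_le_mul_of_nonneg_left h1 (sub_nonneg.2 hxy)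
    rw [← relEntSlope_sub hσ hω hx hxy hy] at h2
    have h3 := mul_le_mul_of_nonneg_left (hlog x y hx hxy hy)
      (by positivity : 0 ≤ n / (c - 1) ^ 2)
    rw [← mul_assoc (n / (c - 1) ^ 2), div_mul_cancel₀ _ (by positivity)] at h3
    have h4 := inv_one_add_mul_sub_inv hcp hx hxy hy
    have h5 : (1 + x * (c - 1))⁻¹ * (1 + y * (c - 1))⁻¹ ≤ 1 :=
      mul_le_one₀ (hinv x hx).2 (hinv y (hx.trans hxy)).1 (hinv y (hx.trans hxy)).2
    have h6 := mul_le_mul_of_nonneg_left h5 (mul_nonneg hc0.le (sub_nonneg.2 hxy))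
    rw [← h4] at h6
    have h7 := mul_le_mul_of_nonneg_left h6 (mul_nonneg hn0 (sub_nonneg.2 hxy))
    linarith
  · refine (hlog x y hx hxy hy).trans (mul_le_mul_of_nonneg_left ?_ (sq_nonneg _))
    exact mul_le_of_le_one_right (sub_nonneg.2 hxy) (hinv x hx).2

/-- Comparison of the relative entropies with respect to `σ` and to a perturbation of `σ`. -/
lemma mul_relEnt_sub_eigenForm_le {c ζ : ℝ} (hc : 1 ≤ c) (hζ : ζ ∈ Set.Ioo (0 : ℝ) 1)
    (hσ : σ.PosDef) (hω : ω.PosDef) (hρ : ρ.PosDef) (hωσ : ω.trace = σ.trace)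
    (hρσ : ρ.trace = σ.trace) (hdom : (c • σ - ω).PosSemidef) :
    (1 - ζ) * (relEnt ρ σ - ζ * eigenForm (logKernel 1) hσ.1 hσ.1 (ω - σ)) ≤
      (1 + ζ * (c - 1)) * relEnt ρ (σ + ζ • (ω - σ)) := by
  obtain ⟨ε, hε, hρε⟩ := exists_smul_le hρ hσ.1
  have hη := posDef_segment hσ hω hζ.1.le hζ.2.le
  set η := σ + ζ • (ω - σ) with hη_def
  have hρη : ρ.trace = η.trace := by rw [hρσ, trace_segment hωσ]
  set n := eigenForm (logKernel 1) hσ.1 hσ.1 (ω - σ) with hn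
  have hn0 : 0 ≤ n := eigenForm_logKernel_one_nonneg hσ hσ _
  have hζ1 : 0 < 1 - ζ := sub_pos.2 hζ.2
  have hε0 : 0 < ε := hε.1
  have hε1 : 0 < 1 - ε := sub_pos.2 hε.2
  set K := 1 + ζ * (c - 1) with hK_def
  have hK : 0 < K := add_pos_of_pos_of_nonneg one_pos (mul_nonneg hζ.1.le (sub_nonneg.2 hc))
  set γ := (1 - ζ) / K with hγ_def
  have hγ : 0 ≤ γ := by positivity
  have hζ0 : 0 ≤ ζ := hζ.1.le
  have hinv : ∀ x : ℝ, 0 ≤ x → x ≤ 1 →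
      0 ≤ (1 + x * (ε - 1))⁻¹ ∧ (1 + x * (ε - 1))⁻¹ ≤ ε⁻¹ := fun x hx hx1 =>
    ⟨(inv_pos.2 (one_add_mul_sub_one_pos hε0 hx hx1)).le, inv_anti₀ hε0 (by nlinarith)⟩
  have hcmp := (isBregmanPath_relEnt hη hρ hρη).compare (isBregmanPath_relEnt hσ hρ hρσ)
    (isBregmanPath_mul_log hε0) (α := γ) (β := γ * ζ * n / (1 - ε) ^ 2)
    (C := γ * ζ * n * ((1 - ε) * (ε⁻¹ * ε⁻¹)))
    (C' := ε⁻¹ * eigenForm (logKernel 1) hσ.1 hσ.1 (ρ - σ)) hγ (by positivity)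
    (fun x y hx hxy hy => ?_) (fun x y hx hxy hy => ?_)
  · have h1 : ε * Real.log ε - (ε - 1) ≤ (1 - ε) ^ 2 := by
      nlinarith [Real.log_le_sub_one_of_pos hε0]
    have h2 := mul_le_mul_of_nonneg_left h1 (by positivity : 0 ≤ γ * ζ * n / (1 - ε) ^ 2)
    rw [div_mul_cancel₀ _ (by positivity)] at h2
    simp only [one_mul, one_smul, add_sub_cancel] at hcmp
    have h3 : γ * (relEnt ρ σ - ζ * n) ≤ relEnt ρ η := by linarith
    rwa [hγ_def, div_mul_eq_mul_div, div_le_iff₀ hK, mul_comm _ K] at h3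
  · have hxt := hx.trans hxy
    have hdomt : ∀ t : ℝ, 0 ≤ t → t ≤ 1 →
        (K • (σ + t • (ρ - σ)) - (η + t • (ρ - η))).PosSemidef := fun t ht ht1 => by
      have h := (hdom.smul (mul_nonneg (sub_nonneg.2 ht1) hζ0)).add
        (hρ.posSemidef.smul (mul_nonneg ht (mul_nonneg hζ0 (sub_nonneg.2 hc))))
      convert h using 1
      rw [hη_def, hK_def]
      module
    have h1 := eigenForm_logKernel_one_le_mul (posDef_segment hσ hρ hxt hy)
      (posDef_segment hσ hρ hx (hxy.trans hy)) (posDef_segment hη hρ hxt hy)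
      (posDef_segment hη hρ hx (hxy.trans hy)) hK (hdomt y hxt hy) (hdomt x hx (hxy.trans hy))
      (ρ - η)
    have h2 := eigenForm_sub_smul_ge (f := logKernel 1) (posDef_segment hσ hρ hxt hy)
      (posDef_segment hσ hρ hx (hxy.trans hy)) (fun _ _ => logKernel_nonneg 1) hζ0
      (ρ - σ) (ω - σ)
    rw [sub_sub, ← hη_def] at h2
    have h3 := mul_eigenForm_logKernel_one_segment_le hε hσ hρ hρε (ω - σ) hx hxy hy
    rw [← le_inv_mul_iff₀ (one_add_mul_sub_one_pos hε0 hxt hy), ← hn] at h3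
    rw [relEntSlope_sub hσ hρ hx hxy hy, relEntSlope_sub hη hρ hx hxy hy]
    set F := eigenForm (logKernel 1) (posDef_segment hσ hρ hxt hy).1
      (posDef_segment hσ hρ hx (hxy.trans hy)).1 (ρ - σ)
    set M := eigenForm (logKernel 1) (posDef_segment hσ hρ hxt hy).1
      (posDef_segment hσ hρ hx (hxy.trans hy)).1 (ω - σ)
    set N' := eigenForm (logKernel 1) (posDef_segment hη hρ hxt hy).1
      (posDef_segment hη hρ hx (hxy.trans hy)).1 (ρ - η)
    have h4 : γ * F - γ * ζ * M ≤ N' := by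
      have h := (h2.trans h1)
      rw [← div_le_iff₀' hK] at h
      refine le_of_eq_of_le ?_ h
      rw [hγ_def]
      ring
    have hlog := mul_le_mul_of_nonneg_left (log_sub_log_one_add_mul_le hε0 hx hxy hy) hε1.le
    have h5 := mul_le_mul_of_nonneg_left hlog (by positivity : 0 ≤ γ * ζ * n / (1 - ε) ^ 2)
    have h6 : γ * ζ * n / (1 - ε) ^ 2 * ((1 - ε) * ((ε - 1) * ((y - x) * (1 + x * (ε - 1))⁻¹))) =
        -(γ * ζ * n * ((y - x) * (1 + x * (ε - 1))⁻¹)) := by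
      rw [div_mul_eq_mul_div, div_eq_iff (by positivity)]
      ring
    rw [h6] at h5
    have h7 := inv_one_add_mul_sub_inv hε0 hx hxy hy
    have h8 : (1 + x * (ε - 1))⁻¹ * (1 + y * (ε - 1))⁻¹ ≤ ε⁻¹ * ε⁻¹ :=
      mul_le_mul (hinv x hx (hxy.trans hy)).2 (hinv y hxt hy).2 (hinv y hxt hy).1
        (inv_nonneg.2 hε0.le)
    have hyx := sub_nonneg.2 hxy
    have h9 := mul_le_mul_of_nonneg_left h8 (mul_nonneg hε1.le hyx)
    have h10 : (1 + y * (ε - 1))⁻¹ - (1 + x * (ε - 1))⁻¹ ≤ (1 - ε) * (y - x) * (ε⁻¹ * ε⁻¹) := by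
      linarith
    have hγn : 0 ≤ γ * ζ * (y - x) := by positivity
    have h11 := mul_le_mul_of_nonneg_left h10 (mul_nonneg hγn hn0)
    have h12 := mul_le_mul_of_nonneg_left h3 hγn
    have h13 := mul_le_mul_of_nonneg_left h4 hyx
    linarith
  · have h1 := mul_eigenForm_logKernel_one_segment_le hε hσ hρ hρε (ρ - σ) hx hxy hy
    rw [← le_inv_mul_iff₀ (one_add_mul_sub_one_pos hε0 (hx.trans hxy) hy)] at h1
    rw [relEntSlope_sub hσ hρ hx hxy hy, mul_comm]
    refine mul_le_mul_of_nonneg_right (h1.trans ?_) (sub_nonneg.2 hxy)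
    exact mul_le_mul_of_nonneg_right (hinv y (hx.trans hxy) hy).2
      (eigenForm_logKernel_one_nonneg hσ hσ _)

end EntropyBounds

section QuasiFactorization

variable {d : ℕ} {ρ σ ω : Matrix (Fin d) (Fin d) ℂ}

lemma mul_log_sub_one_add_one_pos {c : ℝ} (hc : 1 < c) : 0 < c * (Real.log c - 1) + 1 := by
  have h0 : 0 < c := zero_lt_one.trans hc
  have h1 := Real.log_lt_sub_one_of_pos (inv_pos.2 h0) (inv_lt_one_of_one_lt₀ hc).ne
  rw [Real.log_inv] at h1
  have h2 := mul_lt_mul_of_pos_left h1 h0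
  rw [mul_sub, mul_inv_cancel₀ h0.ne'] at h2
  linarith

lemma mul_relEnt_le_mul_relEnt_segment {c ζ : ℝ} (hc : 1 ≤ c) (hζ : ζ ∈ Set.Ioo (0 : ℝ) 1)
    (hσ : σ.PosDef) (hω : ω.PosDef) (hρ : ρ.PosDef) (hωσ : ω.trace = σ.trace)
    (hρσ : ρ.trace = σ.trace) (hdom : (c • σ - ω).PosSemidef)
    (hle : relEnt ω σ ≤ relEnt ρ σ) :
    (1 - ζ) * (1 - ζ * ((c - 1) ^ 2 / (c * (Real.log c - 1) + 1))) * relEnt ρ σ ≤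
      (1 + ζ * (c - 1)) * relEnt ρ (σ + ζ • (ω - σ)) := by
  have hζ1 : 0 ≤ 1 - ζ := sub_nonneg.2 hζ.2.le
  rcases hc.eq_or_lt with rfl | hc1
  · have h : σ - ω = 0 := by
      rw [one_smul] at hdom
      rw [← hdom.trace_eq_zero_iff, trace_sub, hωσ, sub_self]
    have hD := relEnt_nonneg hρ hσ hρσ
    simp only [(sub_eq_zero.1 h).symm, sub_self, smul_zero, add_zero, mul_zero, one_mul]
    have := mul_nonneg hζ.1.le hD
    norm_num
    linarith
  · have hL := mul_log_sub_one_add_one_pos hc1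
    have h1 := mul_eigenForm_logKernel_one_le_relEnt hc1 hσ hω hωσ hdom
    have h2 := h1.trans (mul_le_mul_of_nonneg_left hle (sq_nonneg (c - 1)))
    rw [show c * Real.log c - (c - 1) = c * (Real.log c - 1) + 1 by ring, ← le_div_iff₀' hL,
      mul_div_right_comm] at h2
    refine le_trans ?_ (mul_relEnt_sub_eigenForm_le hc hζ hσ hω hρ hωσ hρσ hdom)
    rw [mul_assoc]
    refine mul_le_mul_of_nonneg_left ?_ hζ1
    have := mul_le_mul_of_nonneg_left h2 hζ.1.le
    linarith

lemma quasi_factorization_const_mul_le {c ζ D R : ℝ} (hc : 1 ≤ c) (hζ : ζ ∈ Set.Ioo (0 : ℝ) 1)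
    (hD : 0 ≤ D) (hR : 0 ≤ R)
    (h : (1 - ζ) * (1 - ζ * ((c - 1) ^ 2 / (c * (Real.log c - 1) + 1))) * D ≤
      (1 + ζ * (c - 1)) * R) :
    (1 / (1 + ζ * (c + 1) + 2 * ζ ^ 2 * (c - 1))) *
      (1 - 3 * ζ * (2 + ζ) * (c - 1) ^ 2 / (c * (Real.log c - 1) + 1) - 8 * ζ - 2 * ζ ^ 2) * D ≤
        R := by
  have hζ0 := hζ.1
  have hc0 : 0 ≤ c - 1 := sub_nonneg.2 hc
  have hr : 0 ≤ (c - 1) ^ 2 / (c * (Real.log c - 1) + 1) := by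
    rcases hc.eq_or_lt with rfl | hc1
    · simp
    · exact div_nonneg (sq_nonneg _) (mul_log_sub_one_add_one_pos hc1).le
  rw [mul_div_assoc]
  set r := (c - 1) ^ 2 / (c * (Real.log c - 1) + 1)
  have hP : 0 < 1 + ζ * (c + 1) + 2 * ζ ^ 2 * (c - 1) := by positivity
  rw [mul_assoc, one_div, inv_mul_le_iff₀ hP]
  have h1 : 1 - 3 * ζ * (2 + ζ) * r - 8 * ζ - 2 * ζ ^ 2 ≤ (1 - ζ) * (1 - ζ * r) := by
    have : 0 ≤ ζ * r := by positivity
    have : 0 ≤ ζ ^ 2 * r := by positivity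
    nlinarith [sq_nonneg ζ]
  have h2 : 1 + ζ * (c - 1) ≤ 1 + ζ * (c + 1) + 2 * ζ ^ 2 * (c - 1) := by
    have : 0 ≤ ζ ^ 2 * (c - 1) := by positivity
    linarith
  exact (mul_le_mul_of_nonneg_right h1 hD).trans (h.trans (mul_le_mul_of_nonneg_right h2 hR))

/-- A positive trace-preserving unital map, intertwined with a conditional expectation, does not
increase the relative entropy to the image of the latter. -/
lemma IsCondExp.relEnt_map_le_of_map_map {N : StarSubalgebra ℂ (Matrix (Fin d) (Fin d) ℂ)}
    {E T : Matrix (Fin d) (Fin d) ℂ →ₗ[ℂ] Matrix (Fin d) (Fin d) ℂ} (h : IsCondExp N E)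
    (hT : ∀ X, X.PosSemidef → (T X).PosSemidef) (hTtr : ∀ X, (T X).trace = X.trace)
    (hT1 : T 1 = 1) (hρ : ρ.PosDef) (hET : E (T ρ) = E ρ) :
    relEnt (T ρ) (E ρ) ≤ relEnt ρ (E ρ) := by
  have h1 := re_trace_mul_matLog_map_le hT hTtr hT1 hρ.posSemidef
  have hH := (h.posDef hρ).1
  have h2 := h.trace_map_mul_matLog (ρ := T ρ) hH (h.map_mem ρ)
  have h3 := h.trace_map_mul_matLog (ρ := ρ) hH (h.map_mem ρ)
  rw [hET, h3] at h2
  rw [relEnt_eq, relEnt_eq, ← h2]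
  linarith

variable {J : ℕ} {Ns : Fin J → StarSubalgebra ℂ (Matrix (Fin d) (Fin d) ℂ)}
  {Es : Fin J → (Matrix (Fin d) (Fin d) ℂ →ₗ[ℂ] Matrix (Fin d) (Fin d) ℂ)}

lemma relEnt_sum_compSeq_le (hE : ∀ j, IsCondExp (Ns j) (Es j)) (hρ : ρ.PosDef)
    {S : Finset (List (Fin J))} {μ : List (Fin J) → ℝ} (hμ : ∀ s ∈ S, 0 ≤ μ s)
    (hμ1 : ∑ s ∈ S, μ s = 1) {k : List (Fin J) → Fin J → ℕ}
    (hk : ∀ s ∈ S, ∀ j, s.count j ≤ k s j)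
    (hη : (∑ s ∈ S, μ s • compSeq Es s ρ).PosDef) :
    relEnt ρ (∑ s ∈ S, μ s • compSeq Es s ρ) ≤
      ∑ s ∈ S, μ s * ∑ j, (k s j : ℝ) * relEnt ρ (Es j ρ) := by
  refine (relEnt_sum_le S μ hμ hμ1 hρ (posDef_compSeq hE hρ) (trace_compSeq hE ρ) hη).trans
    (Finset.sum_le_sum fun s hs => mul_le_mul_of_nonneg_left ?_ (hμ s hs))
  refine (relEnt_compSeq_le hE hρ s).trans (Finset.sum_le_sum fun j _ => ?_)
  exact mul_le_mul_of_nonneg_right (Nat.cast_le.2 (hk s hs j))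
    (relEnt_nonneg hρ ((hE j).posDef hρ) ((hE j).trace_map ρ).symm)

end QuasiFactorization

/-- **Theorem 1.7 (Quasi-factorization, tracial case, finitely supported measure).**
Each `Es j` is the Hilbert–Schmidt orthogonal projection onto the unital *-subalgebra `Ns j`,
and `E` is the Hilbert–Schmidt orthogonal projection onto the intersection `⨅ j, Ns j`. -/
theorem quasi_factorization
    (d J : ℕ)
    (Ns : Fin J → StarSubalgebra ℂ (Matrix (Fin d) (Fin d) ℂ))
    (Es : Fin J → (Matrix (Fin d) (Fin d) ℂ →ₗ[ℂ] Matrix (Fin d) (Fin d) ℂ))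
    (hEsmem : ∀ (j : Fin J) (X : Matrix (Fin d) (Fin d) ℂ), Es j X ∈ Ns j)
    (hEsfix : ∀ (j : Fin J), ∀ X ∈ Ns j, Es j X = X)
    (hEsorth : ∀ (j : Fin J) (X : Matrix (Fin d) (Fin d) ℂ), ∀ Y ∈ Ns j,
      (Yᴴ * (X - Es j X)).trace = 0)
    (E : Matrix (Fin d) (Fin d) ℂ →ₗ[ℂ] Matrix (Fin d) (Fin d) ℂ)
    (hEmem : ∀ X : Matrix (Fin d) (Fin d) ℂ, E X ∈ ⨅ j, Ns j)
    (hEfix : ∀ X ∈ ⨅ j, Ns j, E X = X)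
    (hEorth : ∀ X : Matrix (Fin d) (Fin d) ℂ, ∀ Y ∈ ⨅ j, Ns j,
      (Yᴴ * (X - E X)).trace = 0)
    (S : Finset (List (Fin J))) (hS : ∀ s ∈ S, s ≠ [])
    (μ : List (Fin J) → ℝ)
    (hμ : ∀ s ∈ S, μ s ∈ Set.Icc (0:ℝ) 1) (hμ1 : ∑ s ∈ S, μ s = 1)
    (k : List (Fin J) → Fin J → ℕ)
    (hk : ∀ s ∈ S, ∀ j : Fin J, s.count j ≤ k s j)
    (ζ c : ℝ) (hζ : ζ ∈ Set.Ioo (0:ℝ) 1) (hc : 1 ≤ c)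
    (Φ : Matrix (Fin d) (Fin d) ℂ →ₗ[ℂ] Matrix (Fin d) (Fin d) ℂ)
    (hΦpos : ∀ X : Matrix (Fin d) (Fin d) ℂ, X.PosSemidef → (Φ X).PosSemidef)
    (hΦtr : ∀ X : Matrix (Fin d) (Fin d) ℂ, (Φ X).trace = X.trace)
    (hdecomp : ∀ X : Matrix (Fin d) (Fin d) ℂ,
      ∑ s ∈ S, μ s • compSeq Es s X = (1 - ζ) • E X + ζ • Φ X)
    (ρ : Matrix (Fin d) (Fin d) ℂ) (hρ : ρ.PosDef) (hρtr : ρ.trace = 1)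
    (hdom : (c • E ρ - Φ ρ).PosSemidef) :
    ∑ s ∈ S, μ s * ∑ j : Fin J, (k s j : ℝ) * relEnt ρ (Es j ρ)
      ≥ (1 / (1 + ζ * (c + 1) + 2 * ζ ^ 2 * (c - 1)))
          * (1 - 3 * ζ * (2 + ζ) * (c - 1) ^ 2 / (c * (Real.log c - 1) + 1)
              - 8 * ζ - 2 * ζ ^ 2)
        * relEnt ρ (E ρ) := by
  have hE : ∀ j, IsCondExp (Ns j) (Es j) := fun j => ⟨hEsmem j, hEsfix j, hEsorth j⟩
  have h : IsCondExp (⨅ j, Ns j) E := ⟨hEmem, hEfix, hEorth⟩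
  have hσ := h.posDef hρ
  have hζ0 : ζ ≠ 0 := hζ.1.ne'
  have hΦ1 : Φ 1 = 1 := by
    have h1 := hdecomp 1
    simp only [compSeq_one hE, ← Finset.sum_smul, hμ1, h.map_one, sub_smul, one_smul] at h1
    rw [eq_comm, sub_add, sub_eq_self, ← smul_sub, smul_eq_zero_iff_right hζ0, sub_eq_zero] at h1
    exact h1.symm
  have hEΦ : E (Φ ρ) = E ρ := by
    have h1 := congrArg E (hdecomp ρ)
    simp only [map_sum, map_add, LinearMap.map_smul_of_tower, map_compSeq hE h, ← Finset.sum_smul,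
      hμ1, h.map_of_mem _ (h.map_mem ρ)] at h1
    rw [one_smul, sub_smul, one_smul, eq_comm, sub_add, sub_eq_self, ← smul_sub,
      smul_eq_zero_iff_right hζ0, sub_eq_zero] at h1
    exact h1.symm
  have hω := posDef_map hΦpos hΦ1 hρ
  have hρσ := (h.trace_map ρ).symm
  have hωσ := (hΦtr ρ).trans hρσ
  have hη := posDef_segment hσ hω hζ.1.le hζ.2.le
  have hsum : ∑ s ∈ S, μ s • compSeq Es s ρ = E ρ + ζ • (Φ ρ - E ρ) := by
    rw [hdecomp]
    module
  have hle := relEnt_sum_compSeq_le hE hρ (fun s hs => (hμ s hs).1) hμ1 hk (hsum ▸ hη)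
  rw [hsum] at hle
  refine ge_iff_le.2 (le_trans ?_ hle)
  exact quasi_factorization_const_mul_le hc hζ (relEnt_nonneg hρ hσ hρσ)
    (relEnt_nonneg hρ hη (by rw [trace_segment hωσ, hρσ]))
    (mul_relEnt_le_mul_relEnt_segment hc hζ hσ hω hρ hωσ hρσ hdom
      (h.relEnt_map_le_of_map_map hΦpos hΦtr hΦ1 hρ hEΦ))
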